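/- arXiv:math/9605218 — 4 statements merged into one kernel-verified Lean document; each statement's English description precedes it below -/
import Mathlib

section
/- There exists an absolute constant c > 0 such that: if K is a symmetric convex body in ℝ^n and E is the ellipsoid of maximal volume contained in K, then for every ε ∈ (0,1) there exists a subspace F of ℝ^n with dim F = m ≥ (1−ε)n such that M_{E∩F} ≤ [c · vr(K)]^{1/ε} · M_K. -/
open MeasureTheory Metric Set
open scoped Pointwise

noncomputable section

/-- An ellipsoid in `ℝ^n`: the image of the Euclidean unit ball under an
invertible linear map. -/
def IsEllipsoid {n : ℕ} (E : Set (EuclideanSpace ℝ (Fin n))) : Prop :=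
  ∃ T : EuclideanSpace ℝ (Fin n) ≃ₗ[ℝ] EuclideanSpace ℝ (Fin n),
    E = T '' closedBall 0 1

/-- `M_K = (∫_{S^{n-1}} ‖x‖_K^2 dσ(x))^{1/2}`, where `σ` is the rotation-invariant
probability measure on the Euclidean unit sphere and `‖·‖_K` is the gauge of `K`. -/
def Mval {n : ℕ} (K : Set (EuclideanSpace ℝ (Fin n))) : ℝ :=
  Real.sqrt (⨍ x : sphere (0 : EuclideanSpace ℝ (Fin n)) 1,
    gauge K (x : EuclideanSpace ℝ (Fin n)) ^ 2
      ∂((volume : Measure (EuclideanSpace ℝ (Fin n))).toSphere))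

/-- The quantity `M_K` for a body `K` living in a subspace `F` of `ℝ^n`,
computed over the unit sphere of `F` with its rotation-invariant probability
measure. -/
def MvalSub {n : ℕ} (F : Submodule ℝ (EuclideanSpace ℝ (Fin n))) (K : Set ↥F) : ℝ :=
  Real.sqrt (⨍ x : sphere (0 : ↥F) 1,
    gauge K (x : ↥F) ^ 2 ∂((volume : Measure ↥F).toSphere))

/-- A symmetric convex body in `ℝ^n`: compact, convex, with nonempty interior
and symmetric about the origin. -/
def IsSymmetricConvexBody {n : ℕ} (K : Set (EuclideanSpace ℝ (Fin n))) : Prop :=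
  Convex ℝ K ∧ IsCompact K ∧ (interior K).Nonempty ∧ K = -K

/-- `E` is the maximal volume ellipsoid contained in `K`. -/
def IsMaxVolEllipsoidIn {n : ℕ} (E K : Set (EuclideanSpace ℝ (Fin n))) : Prop :=
  IsEllipsoid E ∧ E ⊆ K ∧
    ∀ E' : Set (EuclideanSpace ℝ (Fin n)), IsEllipsoid E' → E' ⊆ K →
      volume E' ≤ volume E

lemma shear_bound {n : ℕ} (A D : Set (EuclideanSpace ℝ (Fin n)))
    (hA : IsCompact A) (hD : IsCompact D) (S : ENNReal)
    (hS : ∀ w, volume (D ∩ {z | w - z ∈ A}) ≤ S) :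
    volume A * volume D ≤ volume (A + D) * S := by
  set X : Set (EuclideanSpace ℝ (Fin n) × EuclideanSpace ℝ (Fin n)) :=
    {p | p.1 - p.2 ∈ A ∧ p.2 ∈ D} with hX
  have hXm : MeasurableSet X := by
    have h1 : MeasurableSet {p : EuclideanSpace ℝ (Fin n) × EuclideanSpace ℝ (Fin n) |
        p.1 - p.2 ∈ A} := (measurable_fst.sub measurable_snd) hA.measurableSet
    exact h1.inter (measurable_snd hD.measurableSet)
  have h1 := Measure.prod_apply (μ := (volume : Measure (EuclideanSpace ℝ (Fin n))))
    (ν := (volume : Measure (EuclideanSpace ℝ (Fin n)))) hXm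
  have h2 := Measure.prod_apply_symm (μ := (volume : Measure (EuclideanSpace ℝ (Fin n))))
    (ν := (volume : Measure (EuclideanSpace ℝ (Fin n)))) hXm
  rw [h1] at h2
  have h3 : ∀ y, volume ((fun x => (x, y)) ⁻¹' X) = D.indicator (fun _ => volume A) y := by
    intro y
    by_cases hy : y ∈ D
    · have : (fun x => (x, y)) ⁻¹' X = (fun x => x - y) ⁻¹' A := by
        ext x; simp [hX, hy]
      rw [this, indicator_of_mem hy]
      simp [sub_eq_add_neg]
    · have : (fun x => (x, y)) ⁻¹' X = ∅ := by
        ext x; simp [hX, hy]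
      rw [this, indicator_of_notMem hy]; simp
  simp_rw [h3] at h2
  rw [lintegral_indicator hD.measurableSet, lintegral_const,
    Measure.restrict_apply_univ] at h2
  rw [← h2]
  calc ∫⁻ x, volume (Prod.mk x ⁻¹' X)
      ≤ ∫⁻ x, (A + D).indicator (fun _ => S) x := by
        apply lintegral_mono
        intro w
        by_cases hw : w ∈ A + D
        · simp only [indicator_of_mem hw]
          refine le_trans (measure_mono ?_) (hS w)
          intro z hz
          exact ⟨hz.2, hz.1⟩
        · simp only [indicator_of_notMem hw]
          have : Prod.mk w ⁻¹' X = ∅ := by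
            ext z
            simp only [mem_preimage, mem_empty_iff_false, iff_false]
            intro hz
            exact hw ⟨w - z, hz.1, z, hz.2, by simp⟩
          rw [this]; simp
    _ = volume (A + D) * S := by
        rw [lintegral_indicator (hA.add hD).measurableSet, lintegral_const,
          Measure.restrict_apply_univ, mul_comm]

lemma diagonalize {n : ℕ}
    (T : EuclideanSpace ℝ (Fin n) ≃ₗ[ℝ] EuclideanSpace ℝ (Fin n)) :
    ∃ (u : OrthonormalBasis (Fin n) ℝ (EuclideanSpace ℝ (Fin n))) (l : Fin n → ℝ),
      Antitone l ∧ (∀ i, 0 < l i) ∧ ∀ x, ‖T x‖ ^ 2 = ∑ i, l i * (u.repr x i) ^ 2 := by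
  set A : EuclideanSpace ℝ (Fin n) →ₗ[ℝ] EuclideanSpace ℝ (Fin n) := T.toLinearMap
  have hS := A.isSymmetric_adjoint_comp_self
  have hn : Module.finrank ℝ (EuclideanSpace ℝ (Fin n)) = n := by simp
  have key : ∀ x, ‖T x‖ ^ 2 = ∑ i, hS.eigenvalues hn i * ((hS.eigenvectorBasis hn).repr x i) ^ 2 := by
    intro x
    have h1 : ‖T x‖ ^ 2 = inner ℝ x ((LinearMap.adjoint A ∘ₗ A) x) := by
      rw [LinearMap.comp_apply, LinearMap.adjoint_inner_right, real_inner_self_eq_norm_sq]; rfl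
    rw [h1, ← (hS.eigenvectorBasis hn).repr.inner_map_map, PiLp.inner_apply]
    refine Finset.sum_congr rfl fun i _ => ?_
    rw [hS.eigenvectorBasis_apply_self_apply]
    simp; ring
  refine ⟨hS.eigenvectorBasis hn, hS.eigenvalues hn, hS.eigenvalues_antitone hn, ?_, key⟩
  intro i
  have := key (hS.eigenvectorBasis hn i)
  rw [Finset.sum_eq_single i] at this
  · simp at this
    rw [← this]
    have : T (hS.eigenvectorBasis hn i) ≠ 0 := by
      rw [Ne, LinearEquiv.map_eq_zero_iff]
      have := (hS.eigenvectorBasis hn).toBasis.ne_zero i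
      simpa using this
    positivity
  · intro j _ hj
    simp [hj]
  · simp

lemma zero_mem_nhds_body {n : ℕ} {K : Set (EuclideanSpace ℝ (Fin n))}
    (hK : IsSymmetricConvexBody K) : K ∈ nhds (0 : EuclideanSpace ℝ (Fin n)) := by
  obtain ⟨hc, hk, ⟨x, hx⟩, hs⟩ := hK
  rw [← mem_interior_iff_mem_nhds]
  have hx' : -x ∈ interior K := by
    have h := (Homeomorph.neg (EuclideanSpace ℝ (Fin n))).preimage_interior K
    have h2 : (Homeomorph.neg (EuclideanSpace ℝ (Fin n))) ⁻¹' K = K := by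
      conv_rhs => rw [hs]
      rfl
    rw [h2] at h
    rw [← h] at hx
    exact hx
  have := hc.interior hx hx' (a := 1/2) (b := 1/2) (by norm_num) (by norm_num) (by norm_num)
  simpa using this

lemma half_ball {n : ℕ} (hn : 0 < n) {K : Set (EuclideanSpace ℝ (Fin n))}
    (hK : IsSymmetricConvexBody K) (s : ℝ) (hs : 0 < s) (hsM : 2 * Mval K ≤ s) :
    volume.real (ball (0 : EuclideanSpace ℝ (Fin n)) 1) ≤
      2 * volume.real (closedBall (0 : EuclideanSpace ℝ (Fin n)) 1 ∩ s • K) := by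
  have h0 := zero_mem_nhds_body hK
  obtain ⟨hc, hk, -, -⟩ := hK
  set σ := (volume : Measure (EuclideanSpace ℝ (Fin n))).toSphere with hσ
  have hcont : Continuous (fun x : sphere (0 : EuclideanSpace ℝ (Fin n)) 1 =>
      gauge K (x : EuclideanSpace ℝ (Fin n)) ^ 2) :=
    ((continuous_gauge hc h0).comp continuous_subtype_val).pow 2
  have hint : Integrable (fun x : sphere (0 : EuclideanSpace ℝ (Fin n)) 1 =>
      gauge K (x : EuclideanSpace ℝ (Fin n)) ^ 2) σ :=
    hcont.integrable_of_hasCompactSupport (HasCompactSupport.of_compactSpace _)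
  have hmk := mul_meas_ge_le_integral_of_nonneg (μ := σ)
    (Filter.Eventually.of_forall fun x => sq_nonneg _) hint (s ^ 2)
  have huniv : σ.real univ = n * volume.real (ball (0 : EuclideanSpace ℝ (Fin n)) 1) := by
    rw [hσ, Measure.toSphere_real_apply_univ]; simp
  have hb : 0 < volume.real (ball (0 : EuclideanSpace ℝ (Fin n)) 1) :=
    ENNReal.toReal_pos (measure_ball_pos _ _ one_pos).ne' measure_ball_lt_top.ne
  have hn' : (0:ℝ) < n := by exact_mod_cast hn
  have hupos : 0 < σ.real univ := by rw [huniv]; positivity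
  have hM : Mval K ^ 2 = (σ.real univ)⁻¹ * ∫ x : sphere (0 : EuclideanSpace ℝ (Fin n)) 1,
      gauge K (x : EuclideanSpace ℝ (Fin n)) ^ 2 ∂σ := by
    unfold Mval
    rw [average_eq, smul_eq_mul, Real.sq_sqrt]
    have : 0 ≤ ∫ x : sphere (0 : EuclideanSpace ℝ (Fin n)) 1,
      gauge K (x : EuclideanSpace ℝ (Fin n)) ^ 2 ∂σ := integral_nonneg fun x => sq_nonneg _
    positivity
  have hI : ∫ x : sphere (0 : EuclideanSpace ℝ (Fin n)) 1,
      gauge K (x : EuclideanSpace ℝ (Fin n)) ^ 2 ∂σ = σ.real univ * Mval K ^ 2 := by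
    rw [hM]; field_simp
  rw [hI] at hmk
  have hM0 : 0 ≤ Mval K := Real.sqrt_nonneg _
  have hM4 : Mval K ^ 2 ≤ s ^ 2 / 4 := by nlinarith
  set A : Set (sphere (0 : EuclideanSpace ℝ (Fin n)) 1) :=
    {x | s ^ 2 ≤ gauge K (x : EuclideanSpace ℝ (Fin n)) ^ 2} with hA
  have hAm : MeasurableSet A := (isClosed_le continuous_const hcont).measurableSet
  have hA4 : σ.real A ≤ σ.real univ / 4 := by
    have : s ^ 2 * σ.real A ≤ s ^ 2 * (σ.real univ / 4) := by nlinarith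
    exact le_of_mul_le_mul_left this (by positivity)
  have hAc : σ.real univ / 2 ≤ σ.real Aᶜ := by
    rw [measureReal_compl hAm]; linarith
  have hAc2 : σ.real Aᶜ = n * volume.real (Ioo (0:ℝ) 1 • (Subtype.val '' Aᶜ :
      Set (EuclideanSpace ℝ (Fin n)))) := by
    rw [measureReal_def, hσ, Measure.toSphere_apply' _ hAm.compl]
    simp [measureReal_def]
  have hsub : Ioo (0:ℝ) 1 • (Subtype.val '' Aᶜ : Set (EuclideanSpace ℝ (Fin n))) ⊆
      closedBall (0 : EuclideanSpace ℝ (Fin n)) 1 ∩ s • K := by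
    rintro _ ⟨r, hr, _, ⟨⟨y, hy⟩, hyA, rfl⟩, rfl⟩
    have hyn : ‖y‖ = 1 := by simpa using hy
    have hg : gauge K y < s := by
      have : gauge K y ^ 2 < s ^ 2 := by simpa [hA] using hyA
      exact lt_of_pow_lt_pow_left₀ 2 hs.le this
    refine ⟨?_, ?_⟩
    · simp only [mem_closedBall, dist_zero_right, norm_smul, hyn, Real.norm_eq_abs,
        abs_of_pos hr.1, mul_one]
      exact hr.2.le
    · obtain ⟨b, hb0, hbs, k, hk', hky⟩ := exists_lt_of_gauge_lt (absorbent_nhds_zero h0) hg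
      refine ⟨(r * b / s) • k, ?_, ?_⟩
      · refine hc.smul_mem_of_zero_mem (mem_of_mem_nhds h0) hk' ⟨?_, ?_⟩
        · have := hr.1; positivity
        · rw [div_le_one hs]; nlinarith [hr.1, hr.2]
      · simp only at hky ⊢
        rw [← hky, smul_smul, smul_smul]
        congr 1; field_simp
  have hle : volume.real (Ioo (0:ℝ) 1 • (Subtype.val '' Aᶜ : Set (EuclideanSpace ℝ (Fin n)))) ≤
      volume.real (closedBall (0 : EuclideanSpace ℝ (Fin n)) 1 ∩ s • K) :=
    measureReal_mono hsub
      (ne_top_of_le_ne_top measure_closedBall_lt_top.ne (measure_mono inter_subset_left))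
  rw [hAc2, huniv] at hAc
  have : volume.real (ball (0 : EuclideanSpace ℝ (Fin n)) 1) / 2 ≤
    volume.real (Ioo (0:ℝ) 1 • (Subtype.val '' Aᶜ : Set (EuclideanSpace ℝ (Fin n)))) := by
    refine le_of_mul_le_mul_left ?_ hn'
    linarith
  linarith

lemma MvalSub_le {n : ℕ} (F : Submodule ℝ (EuclideanSpace ℝ (Fin n))) (K : Set ↥F) (r : ℝ)
    (hr : 0 ≤ r) (h : ∀ x : F, ‖x‖ = 1 → gauge K x ≤ r) : MvalSub F K ≤ r := by
  unfold MvalSub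
  refine Real.sqrt_le_iff.2 ⟨hr, ?_⟩
  rw [average_eq, smul_eq_mul]
  have h1 := norm_integral_le_of_norm_le_const (μ := (volume : Measure ↥F).toSphere)
    (f := fun x : sphere (0 : ↥F) 1 => gauge K (x : ↥F) ^ 2) (C := r ^ 2)
    (Filter.Eventually.of_forall fun x => by
      have := h x.1 (by simp)
      rw [Real.norm_eq_abs, abs_of_nonneg (sq_nonneg _)]
      exact pow_le_pow_left₀ (gauge_nonneg _) this 2)
  have h2 := (le_abs_self _).trans h1
  calc _ ≤ ((volume : Measure ↥F).toSphere.real univ)⁻¹ *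
        (r ^ 2 * (volume : Measure ↥F).toSphere.real univ) := by
        gcongr
    _ = r ^ 2 * (((volume : Measure ↥F).toSphere.real univ)⁻¹ *
        (volume : Measure ↥F).toSphere.real univ) := by ring
    _ ≤ r ^ 2 * 1 := by gcongr; exact inv_mul_le_one
    _ = r ^ 2 := mul_one _

lemma section_bound {n : ℕ} (u : OrthonormalBasis (Fin n) ℝ (EuclideanSpace ℝ (Fin n)))
    (l : Fin n → ℝ) (hl : Antitone l) (hpos : ∀ i, 0 < l i) (j : Fin n) (s : ℝ) (hs : 0 < s)
    (X : Set (EuclideanSpace ℝ (Fin n)))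
    (hX : ∀ x ∈ X, ∀ y ∈ X, ‖x - y‖ ≤ 2 ∧
      ∑ i, l i * (u.repr (x - y) i) ^ 2 ≤ (2 * s) ^ 2) :
    volume X ≤ ENNReal.ofReal (((√(l j) / s) ^ (j.1 + 1))⁻¹ * 3 ^ n) *
      volume (ball (0 : EuclideanSpace ℝ (Fin n)) 1) := by
  rcases X.eq_empty_or_nonempty with rfl | ⟨z, hz⟩
  · simp
  set q : Fin n → ℝ := fun i => if i ≤ j then √(l j) / s else 1 with hq
  set Q := Matrix.toLin u.toBasis u.toBasis (Matrix.diagonal q) with hQ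
  have hqp : 0 < √(l j) / s := div_pos (Real.sqrt_pos.2 (hpos j)) hs
  have hdet : LinearMap.det Q = (√(l j) / s) ^ (j.1 + 1) := by
    rw [hQ, LinearMap.det_toLin, Matrix.det_diagonal]
    simp only [hq, Finset.prod_ite, Finset.prod_const, one_pow, mul_one]
    congr 1
    rw [← Fin.card_Iic]
    congr 1
    ext i; simp
  have hrep : ∀ x i, u.repr (Q x) i = q i * u.repr x i := by
    intro x i
    have h := congrFun (LinearMap.toMatrix_mulVec_repr u.toBasis u.toBasis Q x) i
    rw [hQ, LinearMap.toMatrix_toLin, Matrix.mulVec_diagonal, ← hQ] at h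
    simpa using h.symm
  have hns : ∀ x, ‖x‖ ^ 2 = ∑ i, (u.repr x i) ^ 2 := by
    intro x
    rw [← u.repr.norm_map x, EuclideanSpace.real_norm_sq_eq]
  have hsub : X ⊆ (fun x => x + -z) ⁻¹' (Q ⁻¹' closedBall 0 3) := by
    intro x hx
    obtain ⟨h1, h2⟩ := hX x hx z hz
    simp only [mem_preimage, mem_closedBall, dist_zero_right, ← sub_eq_add_neg]
    set y := x - z
    refine le_of_sq_le_sq ?_ (by norm_num)
    rw [hns]
    have h3 : ∑ i, (u.repr (Q y) i) ^ 2 ≤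
        ∑ i, (l i * (u.repr y i) ^ 2 / s ^ 2 + (u.repr y i) ^ 2) := by
      refine Finset.sum_le_sum fun i _ => ?_
      rw [hrep]
      by_cases hi : i ≤ j
      · simp only [hq, hi, if_true]
        rw [mul_pow, div_pow, Real.sq_sqrt (hpos j).le]
        have : l j * (u.repr y i) ^ 2 / s ^ 2 ≤ l i * (u.repr y i) ^ 2 / s ^ 2 := by
          gcongr; exact hl hi
        have e : l j / s ^ 2 * (u.repr y i) ^ 2 = l j * (u.repr y i) ^ 2 / s ^ 2 := by ring
        rw [e]
        nlinarith [sq_nonneg (u.repr y i)]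
      · simp only [hq, hi, if_false, one_mul]
        have : 0 ≤ l i * (u.repr y i) ^ 2 / s ^ 2 := by have := hpos i; positivity
        linarith
    rw [Finset.sum_add_distrib, ← Finset.sum_div, ← hns y] at h3
    have h4 : (∑ i, l i * (u.repr y i) ^ 2) / s ^ 2 ≤ 4 := by
      rw [div_le_iff₀ (by positivity)]; linarith
    nlinarith [norm_nonneg y]
  refine (measure_mono hsub).trans ?_
  rw [measure_preimage_add_right, Measure.addHaar_preimage_linearMap _ (by rw [hdet]; positivity),
    Measure.addHaar_closedBall _ _ (by norm_num), hdet, abs_of_pos (by positivity), ← mul_assoc,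
    ← ENNReal.ofReal_mul (by positivity)]
  simp

lemma ellipsoid_compact {n : ℕ}
    (T : EuclideanSpace ℝ (Fin n) ≃ₗ[ℝ] EuclideanSpace ℝ (Fin n)) :
    IsCompact (T '' closedBall 0 1) :=
  (isCompact_closedBall _ _).image T.toContinuousLinearEquiv.continuous

lemma ellipsoid_pos {n : ℕ}
    (T : EuclideanSpace ℝ (Fin n) ≃ₗ[ℝ] EuclideanSpace ℝ (Fin n)) :
    0 < (volume (T '' closedBall 0 1)).toReal := by
  refine ENNReal.toReal_pos ?_ (ellipsoid_compact T).measure_lt_top.ne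
  have h := Measure.addHaar_image_linearMap
    (volume : Measure (EuclideanSpace ℝ (Fin n))) T.toLinearMap (closedBall 0 1)
  have h' : volume (T '' closedBall 0 1) = _ := h
  rw [h']
  have hd : LinearMap.det T.toLinearMap ≠ 0 := T.isUnit_det'.ne_zero
  refine mul_ne_zero ?_ (measure_closedBall_pos _ _ one_pos).ne'
  simpa using hd

lemma core_bound {n : ℕ} (hn : 0 < n) {K : Set (EuclideanSpace ℝ (Fin n))}
    (hK : IsSymmetricConvexBody K)
    (T : EuclideanSpace ℝ (Fin n) ≃ₗ[ℝ] EuclideanSpace ℝ (Fin n))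
    (hEK : T '' closedBall 0 1 ⊆ K)
    (u : OrthonormalBasis (Fin n) ℝ (EuclideanSpace ℝ (Fin n)))
    (l : Fin n → ℝ) (hl : Antitone l) (hpos : ∀ i, 0 < l i)
    (hT : ∀ x, ‖T.symm x‖ ^ 2 = ∑ i, l i * (u.repr x i) ^ 2)
    (j : Fin n) (s : ℝ) (hs : 0 < s) (hsM : 2 * Mval K ≤ s) :
    (√(l j) / s) ^ (j.1 + 1) ≤
      12 ^ n * ((volume K).toReal / (volume (T '' closedBall 0 1)).toReal) := by
  have hEpos := ellipsoid_pos T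
  have hEc := ellipsoid_compact T
  have hhalf := half_ball hn hK s hs hsM
  obtain ⟨hc, hk, -, -⟩ := hK
  set E := T '' closedBall 0 1 with hE
  set L := closedBall (0 : EuclideanSpace ℝ (Fin n)) 1 ∩ s • K with hL
  have hLc : IsCompact L := (isCompact_closedBall _ _).inter (hk.smul s)
  have hDc : IsCompact (s • E) := hEc.smul s
  set t := (√(l j) / s) ^ (j.1 + 1) with ht
  have htp : 0 < t := pow_pos (div_pos (Real.sqrt_pos.2 (hpos j)) hs) _
  have hsh := shear_bound L (s • E) hLc hDc _ (fun w => section_bound u l hl hpos j s hs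
    (s • E ∩ {z | w - z ∈ L}) (by
      rintro x ⟨hx1, hx2⟩ y ⟨hy1, hy2⟩
      constructor
      · have h1 : ‖w - x‖ ≤ 1 := by simpa using hx2.1
        have h2 : ‖w - y‖ ≤ 1 := by simpa using hy2.1
        have e : x - y = (w - y) - (w - x) := by abel
        rw [e]
        exact (norm_sub_le _ _).trans (by linarith)
      · rw [← hT]
        have hb : ∀ x ∈ s • E, ‖T.symm x‖ ≤ s := by
          rintro _ ⟨_, ⟨a, ha, rfl⟩, rfl⟩
          have ha' : ‖a‖ ≤ 1 := by simpa using ha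
          simp only [map_smul, LinearEquiv.symm_apply_apply, norm_smul, Real.norm_eq_abs,
            abs_of_pos hs]
          nlinarith
        have h1 := hb x hx1
        have h2 := hb y hy1
        refine pow_le_pow_left₀ (norm_nonneg _) ?_ 2
        rw [map_sub]
        exact (norm_sub_le _ _).trans (by linarith)))
  rw [← ht] at hsh
  have hsub : L + s • E ⊆ (2 * s) • K := by
    rw [two_mul, hc.add_smul hs.le hs.le]
    exact Set.add_subset_add inter_subset_right (smul_set_mono hEK)
  have hsh2 := hsh.trans (mul_le_mul_left (measure_mono hsub) _)
  have hbt : volume (ball (0 : EuclideanSpace ℝ (Fin n)) 1) ≠ ⊤ := measure_ball_lt_top.ne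
  have hreal := ENNReal.toReal_mono (ENNReal.mul_ne_top (hk.smul (2 * s)).measure_lt_top.ne
    (ENNReal.mul_ne_top ENNReal.ofReal_ne_top hbt)) hsh2
  rw [Measure.addHaar_smul, Measure.addHaar_smul] at hreal
  simp only [ENNReal.toReal_mul, finrank_euclideanSpace, Fintype.card_fin] at hreal
  rw [abs_of_pos (by positivity), abs_of_pos (by positivity),
    ENNReal.toReal_ofReal (by positivity), ENNReal.toReal_ofReal (by positivity),
    ENNReal.toReal_ofReal (by positivity)] at hreal
  simp only [measureReal_def] at hhalf
  have hb : 0 < (volume (ball (0 : EuclideanSpace ℝ (Fin n)) 1)).toReal :=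
    ENNReal.toReal_pos (measure_ball_pos _ _ one_pos).ne' hbt
  set b := (volume (ball (0 : EuclideanSpace ℝ (Fin n)) 1)).toReal
  set a := (volume L).toReal
  set e := (volume E).toReal
  set k := (volume K).toReal with hkdef
  have hk0 : 0 ≤ k := ENNReal.toReal_nonneg
  have hsn : 0 < s ^ n := by positivity
  have h1 : b * (s ^ n * e) ≤ 2 * ((2 * s) ^ n * k * (t⁻¹ * 3 ^ n * b)) := by
    have : b * (s ^ n * e) ≤ 2 * a * (s ^ n * e) := by gcongr
    linarith
  have h2 : (b * s ^ n) * (t * e) ≤ (b * s ^ n) * (2 * 6 ^ n * k) := by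
    have h3 := mul_le_mul_of_nonneg_left h1 htp.le
    have e6 : (6:ℝ) ^ n = 2 ^ n * 3 ^ n := by rw [← mul_pow]; norm_num
    calc (b * s ^ n) * (t * e) = t * (b * (s ^ n * e)) := by ring
      _ ≤ _ := h3
      _ = (t * t⁻¹) * ((b * s ^ n) * (2 * 6 ^ n * k)) := by rw [e6, mul_pow]; ring
      _ = _ := by rw [mul_inv_cancel₀ htp.ne', one_mul]
  have h4 := le_of_mul_le_mul_left h2 (by positivity)
  rw [← mul_div_assoc, le_div_iff₀ hEpos]
  refine h4.trans ?_
  have e12 : (12:ℝ) ^ n = 2 ^ n * 6 ^ n := by rw [← mul_pow]; norm_num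
  rw [e12]
  have : (2:ℝ) ≤ 2 ^ n := le_self_pow₀ (by norm_num) hn.ne'
  gcongr

/-- Lemma 4.2: there is an absolute constant `c > 0` such that if `E` is the maximal
volume ellipsoid of a symmetric convex body `K` in `ℝ^n`, then for every `ε ∈ (0,1)`
there is a subspace `F` with `dim F ≥ (1-ε)n` and
`M_{E∩F} ≤ [c vr(K)]^{1/ε} M_K`, where `vr(K) = (|K|/|E|)^{1/n}`. -/
theorem Mvalue_section_maximal_ellipsoid_le_volume_ratio :
    ∃ c : ℝ, 0 < c ∧
      ∀ (n : ℕ) (K E : Set (EuclideanSpace ℝ (Fin n))),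
        IsSymmetricConvexBody K → IsMaxVolEllipsoidIn E K →
        ∀ ε : ℝ, ε ∈ Set.Ioo (0 : ℝ) 1 →
          ∃ F : Submodule ℝ (EuclideanSpace ℝ (Fin n)),
            (1 - ε) * (n : ℝ) ≤ (Module.finrank ℝ F : ℝ) ∧
            MvalSub F (Subtype.val ⁻¹' E) ≤
              (c * ((volume K).toReal / (volume E).toReal) ^ ((1 : ℝ) / n)) ^
                  ((1 : ℝ) / ε) * Mval K := by
  refine ⟨24, by norm_num, ?_⟩
  intro n K E hK hE ε hε
  obtain ⟨⟨T, rfl⟩, hEK, -⟩ := hE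
  have hV0 : 0 ≤ (volume K).toReal / (volume (T '' closedBall 0 1)).toReal := by positivity
  have hM0 : 0 ≤ Mval K := Real.sqrt_nonneg _
  rcases Nat.eq_zero_or_pos n with rfl | hn
  · refine ⟨⊤, by simp, ?_⟩
    refine MvalSub_le _ _ _ (by positivity) ?_
    intro x hx
    have : x = 0 := Subsingleton.elim _ _
    simp [this] at hx
  have hn' : (0:ℝ) < n := by exact_mod_cast hn
  obtain ⟨hε0, hε1⟩ := hε
  have hfl : ⌊ε * n⌋₊ < n := by
    rw [Nat.floor_lt (by positivity)]; nlinarith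
  obtain ⟨u, l, hl, hpos, hT⟩ := diagonalize T.symm
  set j : Fin n := ⟨⌊ε * n⌋₊, hfl⟩ with hj
  have hj1 : (j.1 : ℝ) ≤ ε * n := Nat.floor_le (by positivity)
  have hj2 : ε * n ≤ ((j.1 + 1 : ℕ) : ℝ) := by
    push_cast; exact (Nat.lt_floor_add_one _).le
  refine ⟨Submodule.span ℝ (Set.range fun i : {i // j ≤ i} => u i), ?_, ?_⟩
  · have hli : LinearIndependent ℝ (fun i : {i // j ≤ i} => u i) :=
      u.orthonormal.linearIndependent.comp (fun i : {i // j ≤ i} => i.1) Subtype.val_injective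
    rw [finrank_span_eq_card hli]
    have hcard : Fintype.card {i // j ≤ i} = n - j.1 := by
      rw [Fintype.card_subtype, ← Fin.card_Ici]
      congr 1
      ext i; simp
    rw [hcard, Nat.cast_sub hfl.le]
    linarith
  have hEpos := ellipsoid_pos T
  have hVpos : 1 ≤ (volume K).toReal / (volume (T '' closedBall 0 1)).toReal := by
    rw [one_le_div hEpos]
    exact ENNReal.toReal_mono hK.2.1.measure_lt_top.ne (measure_mono hEK)
  set V := (volume K).toReal / (volume (T '' closedBall 0 1)).toReal with hV
  set v := V ^ ((1:ℝ) / n) with hv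
  have hv1 : 1 ≤ v := Real.one_le_rpow hVpos (by positivity)
  have hvn : v ^ n = V := by
    rw [hv, ← Real.rpow_natCast, ← Real.rpow_mul hV0, one_div_mul_cancel hn'.ne', Real.rpow_one]
  have hy1 : 1 ≤ 12 * v := by linarith
  have hlj : 0 < √(l j) := Real.sqrt_pos.2 (hpos j)
  have hmain : ∀ s : ℝ, 0 < s → 2 * Mval K ≤ s → √(l j) ≤ (12 * v) ^ ((1:ℝ) / ε) * s := by
    intro s hs hsM
    have h := core_bound hn hK T hEK u l hl hpos hT j s hs hsM
    rw [← hV, ← hvn, ← mul_pow] at h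
    rw [← div_le_iff₀ hs]
    by_contra! hcon
    have h1 : ((12 * v) ^ ((1:ℝ) / ε)) ^ (j.1 + 1) < (√(l j) / s) ^ (j.1 + 1) :=
      pow_lt_pow_left₀ hcon (by positivity) (by omega)
    have h2 : (12 * v) ^ n ≤ ((12 * v) ^ ((1:ℝ) / ε)) ^ (j.1 + 1) := by
      rw [← Real.rpow_natCast, ← Real.rpow_natCast, ← Real.rpow_mul (by positivity)]
      refine Real.rpow_le_rpow_of_exponent_le hy1 ?_
      rw [one_div, inv_mul_eq_div, le_div_iff₀ hε0]
      linarith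
    linarith
  have hfin : √(l j) ≤ (12 * v) ^ ((1:ℝ) / ε) * (2 * Mval K) := by
    have hc : 0 < (12 * v) ^ ((1:ℝ) / ε) := by positivity
    rw [← div_le_iff₀' hc]
    refine le_of_forall_pos_le_add fun δ hδ => ?_
    rw [div_le_iff₀' hc]
    exact hmain _ (by positivity) (by linarith)
  have hfin2 : √(l j) ≤ (24 * v) ^ ((1:ℝ) / ε) * Mval K := by
    refine hfin.trans ?_
    have e : (24 * v) ^ ((1:ℝ) / ε) = (12 * v) ^ ((1:ℝ) / ε) * 2 ^ ((1:ℝ) / ε) := by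
      rw [← Real.mul_rpow (by positivity) (by norm_num)]; congr 1; ring
    have h2 : (2:ℝ) ≤ 2 ^ ((1:ℝ) / ε) := by
      refine Real.self_le_rpow_of_one_le (by norm_num) ?_
      rw [le_div_iff₀ hε0]; linarith
    rw [e, mul_assoc]
    gcongr
  refine (MvalSub_le _ _ (√(l j)) hlj.le ?_).trans hfin2
  rintro ⟨x, hx⟩ hx1
  have hx1' : ‖x‖ = 1 := hx1
  have hz : ∀ i, i < j → u.repr x i = 0 := by
    intro i hi
    clear hx1 hx1'
    induction hx using Submodule.span_induction with
    | mem x h =>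
      obtain ⟨⟨k, hk⟩, rfl⟩ := h
      have : i ≠ k := (hi.trans_le hk).ne
      simp [this]
    | zero => simp
    | add x y _ _ h1 h2 => simp [h1, h2]
    | smul a x _ h1 => simp [h1]
  have hns : ∑ i, (u.repr x i) ^ 2 = 1 := by
    rw [← EuclideanSpace.real_norm_sq_eq, u.repr.norm_map, hx1']; norm_num
  have hTx : ‖T.symm x‖ ≤ √(l j) := by
    refine Real.le_sqrt_of_sq_le ?_
    rw [hT]
    calc ∑ i, l i * (u.repr x i) ^ 2 ≤ ∑ i, l j * (u.repr x i) ^ 2 := by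
          refine Finset.sum_le_sum fun i _ => ?_
          rcases lt_or_ge i j with h | h
          · simp [hz i h]
          · have := hl h
            gcongr
      _ = l j := by rw [← Finset.mul_sum, hns, mul_one]
  refine gauge_le_of_mem hlj.le ⟨(√(l j))⁻¹ • ⟨x, hx⟩, ?_, ?_⟩
  · refine ⟨(√(l j))⁻¹ • T.symm x, ?_, ?_⟩
    · simp only [mem_closedBall, dist_zero_right, norm_smul, norm_inv, Real.norm_eq_abs,
        abs_of_pos hlj]
      rw [inv_mul_le_one₀ hlj]; exact hTx
    · simp
  · simp [smul_smul, hlj.ne']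
end
end

section
/- There exist absolute constants c, C > 0 such that: if K is a symmetric convex body in ℝ^n with ‖x‖_K ≤ b|x| for all x ∈ ℝ^n, then M_K ≤ (c/λ_K) · N_{K°}^{t/n} for some natural number t ≤ C(b/M_K)². -/
open MeasureTheory Metric Set
open scoped Pointwise

noncomputable section

/-- The covering number `N(K, L)`: the smallest `N` such that `K` can be covered by
`N` translates of `L`. -/
def coveringNumber {n : ℕ} (K L : Set (EuclideanSpace ℝ (Fin n))) : ℕ :=
  sInf {N : ℕ | ∃ t : Finset (EuclideanSpace ℝ (Fin n)), t.card = N ∧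
    K ⊆ ⋃ x ∈ t, x +ᵥ L}

/-- The volume radius `λ_K = (|K|/|D_n|)^{1/n}`. -/
def volRadius {n : ℕ} (K : Set (EuclideanSpace ℝ (Fin n))) : ℝ :=
  ((volume K).toReal /
    (volume (closedBall (0 : EuclideanSpace ℝ (Fin n)) 1)).toReal) ^ ((1 : ℝ) / n)

/-- `N_K = N(K, λ_K D_n)`. -/
def NcovK {n : ℕ} (K : Set (EuclideanSpace ℝ (Fin n))) : ℕ :=
  coveringNumber K (volRadius K • closedBall 0 1)

/-- The polar body `K° = {y : ⟨y, x⟩ ≤ 1 for all x ∈ K}`. -/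
def polarSet {n : ℕ} (K : Set (EuclideanSpace ℝ (Fin n))) :
    Set (EuclideanSpace ℝ (Fin n)) :=
  {y | ∀ x ∈ K, inner (𝕜 := ℝ) y x ≤ 1}

open ProbabilityTheory

abbrev EE (n : ℕ) := EuclideanSpace ℝ (Fin n)

/-- gaussian density constant -/
def gDens (n : ℕ) (x : EE n) : ℝ := (2 * Real.pi) ^ (-(n:ℝ)/2) * Real.exp (-‖x‖^2/2)

lemma gDens_pos (n : ℕ) (x : EE n) : 0 < gDens n x := by unfold gDens; positivity

lemma gDens_cont (n : ℕ) : Continuous (gDens n) := by unfold gDens; fun_prop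

lemma gDens_char (n : ℕ) (t : EE n) :
    ∫ x : EE n, (gDens n x : ℂ) * Complex.exp (inner ℝ x t * Complex.I)
      = Complex.exp (-‖t‖^2/2) := by
  have h := GaussianFourier.integral_cexp_neg_mul_sq_norm_add (V := EE n) (b := 1/2) (by norm_num)
    Complex.I t
  have h2 : ∀ x : EE n, (gDens n x : ℂ) * Complex.exp (inner ℝ x t * Complex.I)
      = (((2 * Real.pi) ^ (-(n:ℝ)/2) : ℝ) : ℂ) *
        Complex.exp (-(1/2) * ‖x‖^2 + Complex.I * inner ℝ t x) := by
    intro x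
    rw [gDens, Complex.ofReal_mul, mul_assoc, Complex.ofReal_exp, ← Complex.exp_add,
      real_inner_comm]
    congr 2
    push_cast
    ring
  simp_rw [h2]
  rw [integral_const_mul, h, ← mul_assoc]
  have h3 : (((2 * Real.pi) ^ (-(n:ℝ)/2) : ℝ) : ℂ) *
      (Real.pi / (1/2) : ℂ) ^ ((Module.finrank ℝ (EE n) : ℂ) / 2) = 1 := by
    rw [Complex.ofReal_cpow (by positivity)]
    have : (Real.pi / (1/2) : ℂ) = ((2 * Real.pi : ℝ) : ℂ) := by push_cast; ring
    rw [this, ← Complex.cpow_add _ _ (by norm_cast; positivity)]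
    simp
    ring_nf
    simp
  rw [h3, one_mul]
  congr 1
  simp
  ring

lemma gDens_int (n : ℕ) : ∫ x : EE n, gDens n x = 1 := by
  have h := gDens_char n 0
  simp only [inner_zero_right, Complex.ofReal_zero, zero_mul, Complex.exp_zero, mul_one, norm_zero] at h
  rw [integral_complex_ofReal] at h
  have : (0:ℂ)^2 = 0 := by norm_num
  simpa using h

lemma gDens_integrable (n : ℕ) : Integrable (gDens n) := by
  by_contra h
  have := gDens_int n
  rw [integral_undef h] at this
  norm_num at this

lemma gDens_lint (n : ℕ) : ∫⁻ x : EE n, ENNReal.ofReal (gDens n x) = 1 := by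
  rw [← ofReal_integral_eq_lintegral_ofReal (gDens_integrable n)
    (Filter.Eventually.of_forall fun x => (gDens_pos n x).le), gDens_int]; simp

lemma stdG_eq (n : ℕ) : stdGaussian (EE n) =
    volume.withDensity (fun x => ENNReal.ofReal (gDens n x)) := by
  have : IsProbabilityMeasure ((volume : Measure (EE n)).withDensity
      (fun x => ENNReal.ofReal (gDens n x))) := ⟨by simp [gDens_lint]⟩
  apply Measure.ext_of_charFun (E := EE n)
  ext t
  rw [charFun_stdGaussian, charFun_apply,
    integral_withDensity_eq_integral_toReal_smul
      ((gDens_cont n).measurable.ennreal_ofReal) (by simp)]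
  rw [← gDens_char]
  congr 1
  ext x
  rw [ENNReal.toReal_ofReal (gDens_pos n x).le]
  simp

lemma stdG_ac (n : ℕ) : stdGaussian (EE n) ≪ volume := by
  rw [stdG_eq]; exact withDensity_absolutelyContinuous _ _

lemma mgf_dual (n : ℕ) (l : EE n →L[ℝ] ℝ) (a : ℝ) :
    ∫⁻ y, ENNReal.ofReal (Real.exp (a * l y)) ∂(stdGaussian (EE n))
      = ENNReal.ofReal (Real.exp (‖l‖^2 * a^2/2)) := by
  have h : (stdGaussian (EE n)).map l = gaussianReal 0 (‖l‖^2).toNNReal := by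
    rw [IsGaussian.map_eq_gaussianReal, integral_strongDual_stdGaussian, variance_dual_stdGaussian]
  have h1 := mgf_gaussianReal h a
  have h2 : Integrable (fun y => Real.exp (a * l y)) (stdGaussian (EE n)) := by
    have : Integrable (fun x => Real.exp (a * x)) ((stdGaussian (EE n)).map l) := by
      rw [h]; exact integrable_exp_mul_gaussianReal a
    exact this.comp_measurable l.continuous.measurable
  rw [← ofReal_integral_eq_lintegral_ofReal h2 (Filter.Eventually.of_forall fun x => by positivity)]
  rw [mgf] at h1
  rw [h1]
  congr 2
  rw [Real.coe_toNNReal _ (by positivity)]; ring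


open ProbabilityTheory

lemma rot_inv (n : ℕ) (θ : ℝ) : ((stdGaussian (EE n)).prod (stdGaussian (EE n))).map
    (ContinuousLinearMap.rotation θ) = (stdGaussian (EE n)).prod (stdGaussian (EE n)) :=
  IsGaussian.map_rotation_eq_self (by simp) θ

lemma rot_ftc (n : ℕ) {F : EE n → ℝ} {c : NNReal} (hF : LipschitzWith c F) (p : EE n × EE n)
    (hp : ∀ᵐ θ ∂(volume.restrict (Ioc (0:ℝ) (Real.pi/2))),
      DifferentiableAt ℝ F (ContinuousLinearMap.rotation θ p).1) :
    F p.2 - F p.1 = ∫ θ in (0:ℝ)..(Real.pi/2),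
      fderiv ℝ F (ContinuousLinearMap.rotation θ p).1 (ContinuousLinearMap.rotation θ p).2 := by
  have hd : ∀ θ : ℝ, HasDerivAt (fun θ : ℝ => (ContinuousLinearMap.rotation θ p).1)
      (ContinuousLinearMap.rotation θ p).2 θ := by
    intro θ
    simp only [ContinuousLinearMap.rotation_apply]
    exact ((Real.hasDerivAt_cos θ).smul_const p.1).add ((Real.hasDerivAt_sin θ).smul_const p.2)
  have hlip : LipschitzWith (‖p.1‖₊ + ‖p.2‖₊) (fun θ : ℝ => (ContinuousLinearMap.rotation θ p).1) := by
    apply lipschitzWith_of_nnnorm_deriv_le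
    · intro θ; exact (hd θ).differentiableAt
    · intro θ
      rw [(hd θ).deriv]
      simp only [ContinuousLinearMap.rotation_apply]
      rw [← NNReal.coe_le_coe]
      push_cast
      refine (norm_add_le _ _).trans (add_le_add ?_ ?_)
      · rw [norm_smul, norm_neg]
        exact mul_le_of_le_one_left (norm_nonneg _) (Real.abs_sin_le_one θ)
      · rw [norm_smul]
        exact mul_le_of_le_one_left (norm_nonneg _) (Real.abs_cos_le_one θ)
  have hac : AbsolutelyContinuousOnInterval (fun θ : ℝ => F (ContinuousLinearMap.rotation θ p).1)
      0 (Real.pi/2) :=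
    ((hF.comp hlip).lipschitzOnWith).absolutelyContinuousOnInterval
  have h := hac.integral_deriv_eq_sub
  have h2 : F p.2 - F p.1 = (fun θ : ℝ => F (ContinuousLinearMap.rotation θ p).1) (Real.pi/2) -
      (fun θ : ℝ => F (ContinuousLinearMap.rotation θ p).1) 0 := by
    simp [ContinuousLinearMap.rotation_apply]
  rw [h2, ← h]
  apply intervalIntegral.integral_congr_ae
  rw [uIoc_of_le (by positivity)]
  rw [ae_restrict_iff' measurableSet_Ioc] at hp
  filter_upwards [hp] with θ hθ hθ2
  exact ((hθ hθ2).hasFDerivAt.comp_hasDerivAt θ (hd θ)).deriv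

lemma rot_meas (n : ℕ) : Measurable (fun q : (EE n × EE n) × ℝ =>
    (ContinuousLinearMap.rotation q.2 q.1 : EE n × EE n)) := by
  simp only [ContinuousLinearMap.rotation_apply]
  fun_prop

lemma psi_meas (n : ℕ) (F : EE n → ℝ) (a : ℝ) : Measurable (fun p : EE n × EE n =>
    Real.exp (a * fderiv ℝ F p.1 p.2)) := by
  have h1 : Measurable (fun p : EE n × EE n => fderiv ℝ F p.1 p.2) := by
    exact (isBoundedBilinearMap_apply (𝕜 := ℝ) (E := EE n) (F := ℝ)).continuous.measurable.comp
      (((measurable_fderiv ℝ F).comp measurable_fst).prodMk measurable_snd)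
  fun_prop

lemma rot_jensen (n : ℕ) {F : EE n → ℝ} {c : NNReal} (hF : LipschitzWith c F) (s : ℝ)
    (p : EE n × EE n)
    (hp : ∀ᵐ θ ∂(volume.restrict (Ioc (0:ℝ) (Real.pi/2))),
      DifferentiableAt ℝ F (ContinuousLinearMap.rotation θ p).1) :
    ENNReal.ofReal (Real.exp (s * (F p.2 - F p.1))) ≤ ENNReal.ofReal (2/Real.pi) *
      ∫⁻ θ in Ioc (0:ℝ) (Real.pi/2), ENNReal.ofReal (Real.exp (s * (Real.pi/2) *
      fderiv ℝ F (ContinuousLinearMap.rotation θ p).1 (ContinuousLinearMap.rotation θ p).2)) := by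
  set ν := (volume.restrict (Ioc (0:ℝ) (Real.pi/2))) with hν
  set φ : ℝ → ℝ := fun θ => s * (Real.pi/2) *
      fderiv ℝ F (ContinuousLinearMap.rotation θ p).1 (ContinuousLinearMap.rotation θ p).2 with hφ
  have hpi := Real.pi_pos
  have hν1 : ν univ = ENNReal.ofReal (Real.pi/2) := by simp [hν]
  have hν0 : NeZero ν := ⟨by
    intro h
    rw [h] at hν1
    simp at hν1
    linarith⟩
  have hmφ : Measurable (fun θ : ℝ => fderiv ℝ F (ContinuousLinearMap.rotation θ p).1 (ContinuousLinearMap.rotation θ p).2) := by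
    have h1 := (psi_meas n F 1).comp ((rot_meas n).comp (measurable_prodMk_left (x := p)))
    have h2 := Real.measurable_log.comp h1
    simpa [Function.comp_def] using h2
  have hφm : Measurable φ := hmφ.const_mul _
  have hb : ∀ θ, ‖φ θ‖ ≤ |s * (Real.pi/2)| * (c * (‖p.1‖ + ‖p.2‖)) := by
    intro θ
    rw [hφ, Real.norm_eq_abs, abs_mul]
    refine mul_le_mul_of_nonneg_left ?_ (abs_nonneg _)
    rw [← Real.norm_eq_abs]
    refine (ContinuousLinearMap.le_opNorm _ _).trans ?_
    refine mul_le_mul (norm_fderiv_le_of_lipschitz ℝ hF) ?_ (norm_nonneg _) c.2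
    simp only [ContinuousLinearMap.rotation_apply]
    refine (norm_add_le _ _).trans (add_le_add ?_ ?_)
    · rw [norm_smul, norm_neg]
      exact mul_le_of_le_one_left (norm_nonneg _) (Real.abs_sin_le_one θ)
    · rw [norm_smul]
      exact mul_le_of_le_one_left (norm_nonneg _) (Real.abs_cos_le_one θ)
  have hi : Integrable φ ν :=
    Integrable.of_bound hφm.aestronglyMeasurable _ (Filter.Eventually.of_forall hb)
  have hie : Integrable (Real.exp ∘ φ) ν := by
    refine Integrable.of_bound (Real.measurable_exp.comp hφm).aestronglyMeasurable
      (Real.exp (|s * (Real.pi/2)| * (c * (‖p.1‖ + ‖p.2‖)))) (Filter.Eventually.of_forall ?_)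
    intro θ
    simp only [Function.comp, Real.norm_eq_abs, Real.abs_exp]
    exact Real.exp_le_exp.2 ((le_abs_self _).trans (hb θ))
  have hJ := convexOn_exp.map_average_le (μ := ν) (f := φ) Real.continuous_exp.continuousOn
    isClosed_univ (by simp) hi hie
  have hftc := rot_ftc n hF p hp
  rw [intervalIntegral.integral_of_le (by positivity)] at hftc
  have hr : ν.real univ = Real.pi/2 := by
    rw [measureReal_def, hν1, ENNReal.toReal_ofReal (by positivity)]
  have h1 : (⨍ x, φ x ∂ν) = s * (F p.2 - F p.1) := by
    rw [average_eq, hr, hftc, hφ, integral_const_mul, smul_eq_mul]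
    field_simp
    rfl
  rw [h1, average_eq, hr, smul_eq_mul] at hJ
  refine (ENNReal.ofReal_le_ofReal hJ).trans ?_
  have hie2 : Integrable (fun x => Real.exp (φ x)) ν := hie
  rw [ENNReal.ofReal_mul (by positivity), inv_div,
    ofReal_integral_eq_lintegral_ofReal hie2 (Filter.Eventually.of_forall fun x => by positivity)]

lemma maurey_pisier (n : ℕ) {F : EE n → ℝ} {c : NNReal} (hF : LipschitzWith c F) (s : ℝ) :
    ∫⁻ p, ENNReal.ofReal (Real.exp (s * (F p.2 - F p.1)))
      ∂((stdGaussian (EE n)).prod (stdGaussian (EE n)))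
      ≤ ENNReal.ofReal (Real.exp (Real.pi^2 * s^2 * c^2/8)) := by
  set μ := stdGaussian (EE n) with hμ
  set ν := (volume.restrict (Ioc (0:ℝ) (Real.pi/2))) with hν
  have hpi := Real.pi_pos
  have hD : ∀ᵐ x ∂μ, DifferentiableAt ℝ F x :=
    (stdG_ac n).ae_le hF.ae_differentiableAt
  have hDm : MeasurableSet {x | DifferentiableAt ℝ F x} := measurableSet_of_differentiableAt ℝ F
  have h1 : ∀ᵐ p ∂(μ.prod μ), ∀ᵐ θ ∂ν,
      DifferentiableAt ℝ F (ContinuousLinearMap.rotation θ p).1 := by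
    rw [Measure.ae_ae_comm]
    · refine Filter.Eventually.of_forall fun θ => ?_
      have h2 : ∀ᵐ p ∂(μ.prod μ), DifferentiableAt ℝ F p.1 :=
        Measure.quasiMeasurePreserving_fst.ae hD
      rw [hμ, ← rot_inv n θ] at h2
      exact ae_of_ae_map (ContinuousLinearMap.rotation θ).continuous.measurable.aemeasurable h2
    · exact (measurable_fst.comp (rot_meas n)) hDm
  have hψ := (psi_meas n F (s * (Real.pi/2))).ennreal_ofReal
  set ψ : EE n × EE n → ENNReal := fun p => ENNReal.ofReal (Real.exp (s * (Real.pi/2) * fderiv ℝ F p.1 p.2)) with hψd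
  calc _ ≤ ∫⁻ p, ENNReal.ofReal (2/Real.pi) * ∫⁻ θ, ψ (ContinuousLinearMap.rotation θ p) ∂ν ∂(μ.prod μ) := by
        apply lintegral_mono_ae
        filter_upwards [h1] with p hp
        exact rot_jensen n hF s p hp
    _ = ENNReal.ofReal (2/Real.pi) * ∫⁻ θ, ∫⁻ p, ψ (ContinuousLinearMap.rotation θ p) ∂(μ.prod μ) ∂ν := by
        rw [lintegral_const_mul' _ _ ENNReal.ofReal_ne_top, lintegral_lintegral_swap]
        exact (hψ.comp (rot_meas n)).aemeasurable
    _ = ENNReal.ofReal (2/Real.pi) * ∫⁻ θ, ∫⁻ p, ψ p ∂(μ.prod μ) ∂ν := by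
        congr 2
        ext θ
        conv_rhs => rw [hμ, ← rot_inv n θ]
        rw [lintegral_map hψ (ContinuousLinearMap.rotation θ).continuous.measurable]
    _ = ∫⁻ p, ψ p ∂(μ.prod μ) := by
        rw [lintegral_const, mul_comm (∫⁻ p, ψ p ∂(μ.prod μ)), ← mul_assoc]
        simp only [hν, Measure.restrict_apply_univ, Real.volume_Ioc, sub_zero]
        rw [← ENNReal.ofReal_mul (by positivity)]
        field_simp
        simp
    _ = ∫⁻ x, ∫⁻ y, ψ (x, y) ∂μ ∂μ := lintegral_prod _ hψ.aemeasurable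
    _ ≤ ∫⁻ x, ENNReal.ofReal (Real.exp (Real.pi^2 * s^2 * c^2/8)) ∂μ := by
        apply lintegral_mono
        intro x
        simp only [hψd]
        rw [mgf_dual]
        apply ENNReal.ofReal_le_ofReal
        apply Real.exp_le_exp.2
        have : ‖fderiv ℝ F x‖^2 ≤ (c:ℝ)^2 :=
          pow_le_pow_left₀ (norm_nonneg _) (norm_fderiv_le_of_lipschitz ℝ hF) 2
        have h4 : 0 ≤ (s * (Real.pi/2))^2/2 := by positivity
        nlinarith [mul_le_mul_of_nonneg_right this h4]
    _ = _ := by simp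

lemma lip_integrable (n : ℕ) {F : EE n → ℝ} {c : NNReal} (hF : LipschitzWith c F) :
    Integrable F (stdGaussian (EE n)) := by
  have h : Integrable (fun x : EE n => |F 0| + c * ‖x‖) (stdGaussian (EE n)) :=
    (integrable_const _).add ((IsGaussian.integrable_id (μ := stdGaussian (EE n))).norm.const_mul _)
  refine h.mono' hF.continuous.aestronglyMeasurable (Filter.Eventually.of_forall fun x => ?_)
  have := hF.dist_le_mul x 0
  rw [Real.dist_eq, dist_zero_right] at this
  rw [Real.norm_eq_abs]
  have h2 : |F x| ≤ |F x - F 0| + |F 0| := by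
    simpa using abs_add_le (F x - F 0) (F 0)
  linarith

/-- concentration mgf -/
lemma conc_mgf (n : ℕ) {F : EE n → ℝ} {c : NNReal} (hF : LipschitzWith c F) (s : ℝ) :
    ∫⁻ x, ENNReal.ofReal (Real.exp (s * (F x - ∫ y, F y ∂(stdGaussian (EE n)))))
      ∂(stdGaussian (EE n))
      ≤ ENNReal.ofReal (Real.exp (Real.pi^2 * s^2 * c^2/8)) := by
  set μ := stdGaussian (EE n) with hμ
  refine le_trans ?_ (maurey_pisier n hF s)
  rw [lintegral_prod_symm _ (by have := hF.continuous; fun_prop)]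
  apply lintegral_mono
  intro y
  simp only
  by_cases hi : ∫⁻ x, ENNReal.ofReal (Real.exp (s * (F y - F x))) ∂μ = ⊤
  · rw [hi]; exact le_top
  have hm : Continuous (fun x => Real.exp (s * (F y - F x))) := by
    have := hF.continuous; fun_prop
  have hii : Integrable (fun x => Real.exp (s * (F y - F x))) μ := by
    refine ⟨hm.aestronglyMeasurable, ?_⟩
    rw [hasFiniteIntegral_iff_ofReal (Filter.Eventually.of_forall fun x => by positivity)]
    exact lt_top_iff_ne_top.2 hi
  rw [← ofReal_integral_eq_lintegral_ofReal hii (Filter.Eventually.of_forall fun x => by positivity)]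
  apply ENNReal.ofReal_le_ofReal
  have hint := lip_integrable n hF
  have hJ := convexOn_exp.map_integral_le (μ := μ) (f := fun x => s * (F y - F x))
    Real.continuous_exp.continuousOn
    isClosed_univ (by simp) (((integrable_const _).sub hint).const_mul _) hii
  rw [integral_const_mul, integral_sub (integrable_const _) hint] at hJ
  simpa using hJ

open ProbabilityTheory

lemma sep_card (k : ℕ) (S : Finset (EE k)) (h1 : ∀ y ∈ S, ‖y‖ = 1)
    (h2 : ∀ y ∈ S, ∀ z ∈ S, y ≠ z → 1/8 < ‖y - z‖) : S.card ≤ 17^k := by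
  have hd : (S : Set (EE k)).PairwiseDisjoint (fun y => ball y (1/16)) := by
    intro y hy z hz hyz
    apply ball_disjoint_ball
    rw [dist_eq_norm]
    have := h2 y hy z hz hyz
    linarith
  have hsub : (⋃ y ∈ S, ball y (1/16 : ℝ)) ⊆ ball (0:EE k) (17/16) := by
    intro w hw
    simp only [mem_iUnion, mem_ball, exists_prop, dist_eq_norm] at hw
    obtain ⟨y, hy, hw⟩ := hw
    rw [mem_ball, dist_zero_right]
    have : ‖w‖ ≤ ‖w - y‖ + ‖y‖ := by simpa using norm_add_le (w - y) y
    rw [h1 y hy] at this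
    linarith
  have hm := measure_mono (μ := (volume : Measure (EE k))) hsub
  rw [measure_biUnion_finset hd (fun _ _ => measurableSet_ball)] at hm
  simp_rw [Measure.addHaar_ball_of_pos volume _ (show (0:ℝ) < 1/16 by norm_num),
    Measure.addHaar_ball_of_pos volume _ (show (0:ℝ) < 17/16 by norm_num)] at hm
  rw [Finset.sum_const, nsmul_eq_mul, ← mul_assoc, finrank_euclideanSpace, Fintype.card_fin] at hm
  rw [ENNReal.mul_le_mul_iff_left (measure_ball_pos volume _ one_pos).ne'
    measure_ball_lt_top.ne] at hm
  have h3 : ENNReal.ofReal ((S.card : ℝ) * (1/16)^k) ≤ ENNReal.ofReal ((17/16)^k) := by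
    rw [ENNReal.ofReal_mul (by positivity)]
    simpa using hm
  rw [ENNReal.ofReal_le_ofReal_iff (by positivity), div_pow, div_pow, one_pow] at h3
  have h4 : (0:ℝ) < 16^k := by positivity
  have : (S.card : ℝ) ≤ 17^k := by
    field_simp at h3
    linarith
  exact_mod_cast this

lemma exists_net (k : ℕ) : ∃ S : Finset (EE k), (∀ y ∈ S, ‖y‖ = 1) ∧ S.card ≤ 17^k ∧
    ∀ y : EE k, ‖y‖ = 1 → ∃ z ∈ S, ‖y - z‖ ≤ 1/8 := by
  let P : ℕ → Prop := fun m => ∃ S : Finset (EE k), S.card = m ∧ (∀ y ∈ S, ‖y‖ = 1) ∧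
    (∀ y ∈ S, ∀ z ∈ S, y ≠ z → 1/8 < ‖y - z‖)
  classical
  have hP0 : P 0 := ⟨∅, by simp⟩
  have hm := Nat.findGreatest_spec (P := P) (n := 17^k) (Nat.zero_le _) hP0
  obtain ⟨S, hS, h1, h2⟩ := hm
  refine ⟨S, h1, sep_card k S h1 h2, ?_⟩
  intro y hy
  by_contra! hcon
  have hyS : y ∉ S := fun h => by have := hcon y h; simp at this; linarith
  have h2' : ∀ u ∈ insert y S, ∀ z ∈ insert y S, u ≠ z → 1/8 < ‖u - z‖ := by
    intro u hu z hz huz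
    rw [Finset.mem_insert] at hu hz
    rcases hu with rfl | hu <;> rcases hz with rfl | hz
    · exact absurd rfl huz
    · exact hcon z hz
    · rw [norm_sub_rev]; exact hcon u hu
    · exact h2 u hu z hz huz
  have h1' : ∀ u ∈ insert y S, ‖u‖ = 1 := by
    intro u hu
    rw [Finset.mem_insert] at hu
    rcases hu with rfl | hu
    · exact hy
    · exact h1 u hu
  have hc : (insert y S).card = S.card + 1 := Finset.card_insert_of_notMem hyS
  have hle := sep_card k _ h1' h2'
  have := Nat.le_findGreatest (P := P) hle ⟨_, rfl, h1', h2'⟩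
  omega

def comb {k n : ℕ} (g : Fin k → EE n) (y : EE k) : EE n := ∑ j, y j • g j

lemma comb_add {k n : ℕ} (g : Fin k → EE n) (y z : EE k) : comb g (y + z) = comb g y + comb g z := by
  simp [comb, add_smul, Finset.sum_add_distrib]
lemma comb_smul {k n : ℕ} (g : Fin k → EE n) (a : ℝ) (y : EE k) : comb g (a • y) = a • comb g y := by
  simp [comb, mul_smul, Finset.smul_sum]
lemma comb_cont {k n : ℕ} (y : EE k) : Continuous (fun g : Fin k → EE n => comb g y) := by
  unfold comb; fun_prop

lemma comb_law (k n : ℕ) (y : EE k) (hy : ‖y‖ = 1) :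
    (Measure.pi (fun _ : Fin k => stdGaussian (EE n))).map (fun g => comb g y)
      = stdGaussian (EE n) := by
  have hm := (comb_cont (n := n) y).measurable
  have : IsProbabilityMeasure ((Measure.pi (fun _ : Fin k => stdGaussian (EE n))).map (fun g => comb g y)) :=
    Measure.isProbabilityMeasure_map hm.aemeasurable
  apply Measure.ext_of_charFun (E := EE n)
  ext t
  rw [charFun_stdGaussian, charFun_apply, integral_map hm.aemeasurable
    (Measurable.aestronglyMeasurable (by fun_prop))]
  have h1 : ∀ g : Fin k → EE n, Complex.exp (inner ℝ (comb g y) t * Complex.I) =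
      ∏ j, Complex.exp (inner ℝ (g j) (y j • t) * Complex.I) := by
    intro g
    rw [← Complex.exp_sum, ← Finset.sum_mul, ← Complex.ofReal_sum, comb, sum_inner]
    simp_rw [real_inner_smul_left, real_inner_smul_right]
  simp_rw [h1]
  rw [integral_fintype_prod_eq_prod (f := fun j (x : EE n) => Complex.exp (inner ℝ x (y j • t) * Complex.I))]
  simp_rw [← charFun_apply, charFun_stdGaussian]
  rw [← Complex.exp_sum]
  congr 1
  have h2 : ∑ j, (y j)^2 = (1:ℝ) := by
    have := EuclideanSpace.real_norm_sq_eq y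
    rw [hy] at this; linarith
  simp_rw [norm_smul]
  have h3 : ((∑ j, (-(‖y j‖*‖t‖)^2/2) : ℝ) : ℂ) = ((-‖t‖^2/2 : ℝ):ℂ) := by
    congr 1
    simp_rw [mul_pow, Real.norm_eq_abs, sq_abs, neg_div, Finset.sum_neg_distrib, mul_div_assoc, ← Finset.sum_mul, h2]
    ring
  push_cast at h3 ⊢
  exact h3

lemma exists_good {Ω ι : Type*} [MeasurableSpace Ω] (P : Measure Ω) [IsProbabilityMeasure P]
    (I : Finset ι) (Φ : ι → Ω → ℝ) (hm : ∀ i ∈ I, Measurable (Φ i))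
    (h : ∀ i ∈ I, ∫⁻ w, ENNReal.ofReal (Real.exp (Φ i w)) ∂P ≤ 1) :
    ∃ w, ∀ i ∈ I, Real.exp (Φ i w) ≤ I.card := by
  have hm2 : Measurable (fun w => ∑ i ∈ I, ENNReal.ofReal (Real.exp (Φ i w))) :=
    Finset.measurable_sum _ fun i hi => (hm i hi).exp.ennreal_ofReal
  have h1 : ∫⁻ w, ∑ i ∈ I, ENNReal.ofReal (Real.exp (Φ i w)) ∂P ≤ I.card := by
    rw [lintegral_finsetSum I fun i hi => (hm i hi).exp.ennreal_ofReal]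
    refine (Finset.sum_le_sum h).trans ?_
    simp
  obtain ⟨w, hw⟩ := exists_le_lintegral hm2.aemeasurable (μ := P)
  refine ⟨w, fun i hi => ?_⟩
  have h2 : ENNReal.ofReal (Real.exp (Φ i w)) ≤ I.card :=
    (Finset.single_le_sum (f := fun i => ENNReal.ofReal (Real.exp (Φ i w))) (fun _ _ => zero_le) hi).trans (hw.trans h1)
  rwa [ENNReal.ofReal_le_natCast] at h2

lemma conc_mgf1 (n : ℕ) {F : EE n → ℝ} {c : NNReal} (hF : LipschitzWith c F) (s : ℝ) :
    ∫⁻ x, ENNReal.ofReal (Real.exp (s * (F x - ∫ y, F y ∂(stdGaussian (EE n))) - Real.pi^2 * s^2 * c^2/8))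
      ∂(stdGaussian (EE n)) ≤ 1 := by
  have := conc_mgf n hF s
  simp_rw [Real.exp_sub, div_eq_mul_inv]
  simp_rw [ENNReal.ofReal_mul (Real.exp_pos _).le]
  rw [lintegral_mul_const' _ _ ENNReal.ofReal_ne_top]
  refine (mul_le_mul_left this _).trans ?_
  rw [← ENNReal.ofReal_mul (Real.exp_pos _).le]
  rw [← div_eq_mul_inv, ← div_eq_mul_inv, div_self (Real.exp_pos _).ne']
  simp

lemma seminorm_lip (n : ℕ) {F : EE n → ℝ} {b : ℝ} (hb : 0 ≤ b) (hadd : ∀ x y, F (x+y) ≤ F x + F y)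
    (hle : ∀ x, F x ≤ b * ‖x‖) : LipschitzWith b.toNNReal F := by
  apply LipschitzWith.of_le_add_mul
  intro x y
  rw [Real.coe_toNNReal _ hb, dist_eq_norm]
  have := hadd y (x - y)
  rw [add_sub_cancel] at this
  linarith [hle (x-y)]

lemma norm_sq_int (n : ℕ) : ∫ x, ‖x‖^2 ∂(stdGaussian (EE n)) = n := by
  have hi : ∀ i : Fin n, ∫ x, (x i)^2 ∂(stdGaussian (EE n)) = 1 ∧ Integrable (fun x : EE n => (x i)^2) (stdGaussian (EE n)) := by
    intro i
    set l : StrongDual ℝ (EE n) := innerSL ℝ (EuclideanSpace.basisFun (Fin n) ℝ i) with hl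
    have hlx : ∀ x, l x = x i := by intro x; simp [hl, PiLp.inner_apply]
    have hv := variance_dual_stdGaussian (E := EE n) l
    have hmem : MemLp l 2 (stdGaussian (EE n)) := IsGaussian.memLp_dual _ _ _ (by simp)
    rw [variance_of_integral_eq_zero hmem.aemeasurable (integral_strongDual_stdGaussian l)] at hv
    have hn : ‖l‖ = 1 := by rw [hl, innerSL_apply_norm]; simp
    rw [hn] at hv
    simp only [hlx] at hv
    refine ⟨by simpa using hv, ?_⟩
    have := hmem.integrable_sq
    simpa only [hlx] using this
  simp_rw [EuclideanSpace.real_norm_sq_eq]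
  rw [integral_finsetSum _ fun i _ => (hi i).2]
  simp [(hi _).1]

lemma norm_int_le (n : ℕ) : ∫ x, ‖x‖ ∂(stdGaussian (EE n)) ≤ Real.sqrt n := by
  apply Real.le_sqrt_of_sq_le
  have hmem : MemLp (fun x : EE n => ‖x‖) 2 (stdGaussian (EE n)) :=
    (IsGaussian.memLp_two_id (μ := stdGaussian (EE n))).norm
  have h := variance_nonneg (fun x : EE n => ‖x‖) (stdGaussian (EE n))
  rw [variance_eq_sub hmem] at h
  have h2 := norm_sq_int n
  simp only [Pi.pow_apply] at h
  linarith

lemma sq_le_exp_of_nonneg (u : ℝ) (hu : 0 ≤ u) : u^2 ≤ Real.exp u := by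
  have h := Real.quadratic_le_exp_of_nonneg (x := u/2) (by linarith)
  have h2 : u ≤ Real.exp (u/2) := by nlinarith [sq_nonneg (u-2)]
  have h3 : Real.exp u = Real.exp (u/2)^2 := by rw [← Real.exp_nat_mul]; congr 1; push_cast; ring
  rw [h3]
  exact pow_le_pow_left₀ hu h2 2

lemma sq_le_exp_add (u : ℝ) : u^2 ≤ Real.exp u + Real.exp (-u) := by
  rcases le_total 0 u with h | h
  · linarith [sq_le_exp_of_nonneg u h, Real.exp_pos (-u)]
  · have := sq_le_exp_of_nonneg (-u) (by linarith)
    rw [neg_sq] at this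
    linarith [Real.exp_pos u]

lemma lip_memLp (n : ℕ) {F : EE n → ℝ} {c : NNReal} (hF : LipschitzWith c F) :
    MemLp F 2 (stdGaussian (EE n)) := by
  have h1 : MemLp (fun x : EE n => (c:ℝ) * ‖x‖) 2 (stdGaussian (EE n)) :=
    (IsGaussian.memLp_two_id (μ := stdGaussian (EE n))).norm.const_mul _
  have h2 : MemLp (fun x : EE n => F x - F 0) 2 (stdGaussian (EE n)) := by
    refine h1.mono (hF.continuous.sub continuous_const).aestronglyMeasurable
      (Filter.Eventually.of_forall fun x => ?_)
    have := hF.dist_le_mul x 0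
    rw [Real.dist_eq, dist_zero_right] at this
    rw [Real.norm_eq_abs, Real.norm_eq_abs]
    exact this.trans (le_abs_self _)
  have h3 := h2.add (memLp_const (F 0))
  simpa [Pi.add_def] using h3

lemma second_moment (n : ℕ) {F : EE n → ℝ} {b : ℝ} (hb : 0 < b) (hF : LipschitzWith b.toNNReal F) :
    ∫ x, (F x)^2 ∂(stdGaussian (EE n)) ≤ (∫ x, F x ∂(stdGaussian (EE n)))^2 + 8 * b^2 := by
  set μ := stdGaussian (EE n)
  set m := ∫ x, F x ∂μ with hm
  have hmem : MemLp F 2 μ := lip_memLp n hF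
  have hv := variance_eq_sub hmem
  have hv2 : Var[F; μ] = ∫ x, (F x - m)^2 ∂μ := variance_eq_integral hmem.aemeasurable
  have key : ∫ x, (F x - m)^2 ∂μ ≤ 8 * b^2 := by
    have hint : Integrable (fun x => (F x - m)^2) μ := (hmem.sub (memLp_const m)).integrable_sq
    rw [← ENNReal.ofReal_le_ofReal_iff (by positivity), ofReal_integral_eq_lintegral_ofReal
      hint (Filter.Eventually.of_forall fun x => by positivity)]
    have h1 := conc_mgf n hF (1/b)
    have h2 := conc_mgf n hF (-1/b)
    have hE : Real.exp (Real.pi^2 * (1/b)^2 * (b.toNNReal:ℝ)^2/8) ≤ 4 := by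
      rw [Real.coe_toNNReal _ hb.le]
      have : Real.pi^2 * (1/b)^2 * b^2/8 = Real.pi^2/8 := by field_simp
      rw [this]
      have h3 := Real.pi_lt_d2
      have h4 : Real.pi^2/8 ≤ 1.25 := by nlinarith [Real.pi_pos]
      refine (Real.exp_le_exp.2 h4).trans ?_
      have h5 := Real.exp_one_lt_d9
      have h6 : Real.exp (1.25) ^ 4 = Real.exp 1 ^ 5 := by
        rw [← Real.exp_nat_mul, ← Real.exp_nat_mul]; norm_num
      by_contra! h7
      have h8 : (4:ℝ)^4 < Real.exp 1.25 ^ 4 := pow_lt_pow_left₀ h7 (by norm_num) (by norm_num)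
      have h9 : Real.exp 1 ^ 5 < 2.7182818286^5 := pow_lt_pow_left₀ h5 (by positivity) (by norm_num)
      rw [h6] at h8
      have h10 := h8.trans h9
      norm_num at h10
    have hE2 : Real.exp (Real.pi^2 * (-1/b)^2 * (b.toNNReal:ℝ)^2/8) ≤ 4 := by
      rw [neg_div, neg_sq]; exact hE
    have h1' := h1.trans (ENNReal.ofReal_le_ofReal hE)
    have h2' := h2.trans (ENNReal.ofReal_le_ofReal hE2)
    have hc := hF.continuous
    calc ∫⁻ x, ENNReal.ofReal ((F x - m)^2) ∂μ
        ≤ ∫⁻ x, ENNReal.ofReal (b^2) * (ENNReal.ofReal (Real.exp (1/b * (F x - m))) +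
          ENNReal.ofReal (Real.exp (-1/b * (F x - m)))) ∂μ := by
          apply lintegral_mono
          intro x
          simp only
          rw [← ENNReal.ofReal_add (by positivity) (by positivity), ← ENNReal.ofReal_mul (by positivity)]
          apply ENNReal.ofReal_le_ofReal
          set u := (F x - m)/b with hu
          have e1 : 1/b * (F x - m) = u := by rw [hu]; ring
          have e2 : -1/b * (F x - m) = -u := by rw [hu]; ring
          have e3 : (F x - m)^2 = b^2 * u^2 := by rw [hu]; field_simp
          rw [e1, e2, e3]
          apply mul_le_mul_of_nonneg_left _ (by positivity)
          exact sq_le_exp_add u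
      _ ≤ ENNReal.ofReal (b^2) * (ENNReal.ofReal 4 + ENNReal.ofReal 4) := by
          rw [lintegral_const_mul' _ _ ENNReal.ofReal_ne_top, lintegral_add_left (by fun_prop)]
          gcongr
      _ = ENNReal.ofReal (8 * b^2) := by
          rw [← ENNReal.ofReal_add (by norm_num) (by norm_num), ← ENNReal.ofReal_mul (by positivity)]
          congr 1; ring
  rw [hv2] at hv
  simp only [Pi.pow_apply] at hv
  rw [← hm] at hv
  linarith

lemma rearr_exp {X k : ℝ} {c : ℕ} (h : Real.exp X ≤ c) (hc : (c:ℝ) ≤ Real.exp k) : X ≤ k :=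
  Real.exp_le_exp.1 (h.trans hc)

lemma card_exp (k : ℕ) (hk : 1 ≤ k) : (3:ℝ) * 17^k ≤ Real.exp (4*k) := by
  have h5 := Real.exp_one_gt_d9
  have h4 : (51:ℝ) ≤ Real.exp 1 ^ 4 := by
    have : (2.7182818283:ℝ)^4 ≤ Real.exp 1 ^ 4 := pow_le_pow_left₀ (by norm_num) h5.le 4
    norm_num at this ⊢
    linarith
  have e : Real.exp (4*k) = (Real.exp 1 ^ 4)^k := by
    rw [← Real.exp_nat_mul, ← Real.exp_nat_mul]; congr 1; push_cast; ring
  rw [e]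
  calc (3:ℝ) * 17^k ≤ 3^k * 17^k := by
        gcongr
        exact le_self_pow₀ (by norm_num) (by omega)
    _ = 51^k := by rw [← mul_pow]; norm_num
    _ ≤ _ := by gcongr

lemma dvor (n k : ℕ) (hk : 1 ≤ k) {F : EE n → ℝ} {b : ℝ} (hb : 0 < b)
    (hadd : ∀ x y, F (x+y) ≤ F x + F y) (hsm : ∀ (a : ℝ) x, F (a • x) = |a| * F x)
    (hle : ∀ x, F x ≤ b * ‖x‖)
    (hm0 : 0 < ∫ x, F x ∂(stdGaussian (EE n)))
    (hkm : 80 * k * b^2 ≤ (∫ x, F x ∂(stdGaussian (EE n)))^2) :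
    ∃ g : Fin k → EE n, ∀ y : EE k,
      (1/4) * (∫ x, F x ∂(stdGaussian (EE n))) * ‖y‖ ≤ F (comb g y) ∧
      ‖comb g y‖ ≤ 2 * Real.sqrt n * ‖y‖ := by
  set m := ∫ x, F x ∂(stdGaussian (EE n)) with hm
  set q := ∫ x, ‖x‖ ∂(stdGaussian (EE n)) with hq
  have hF := seminorm_lip n hb.le hadd hle
  have hq1 : q ≤ Real.sqrt n := norm_int_le n
  have hmq : m ≤ b * q := by
    rw [hm, hq, ← integral_const_mul]
    exact integral_mono (lip_integrable n hF)
      ((IsGaussian.integrable_id (μ := stdGaussian (EE n))).norm.const_mul _) hle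
  have hsn : 0 ≤ Real.sqrt n := Real.sqrt_nonneg _
  have hsn2 : Real.sqrt n ^ 2 = n := Real.sq_sqrt (by positivity)
  set w := Real.sqrt n with hw
  have hmw : m ≤ b * w := hmq.trans (mul_le_mul_of_nonneg_left hq1 hb.le)
  have hkn : 80 * (k:ℝ) ≤ w^2 := by
    have h1 : m^2 ≤ (b*w)^2 := pow_le_pow_left₀ hm0.le hmw 2
    have h2 : 80 * (k:ℝ) * b^2 ≤ w^2 * b^2 := by nlinarith
    exact le_of_mul_le_mul_right h2 (by positivity)
  have hk0 : (1:ℝ) ≤ k := by exact_mod_cast hk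
  have hw0 : 0 < w := by
    rcases hsn.lt_or_eq with h | h
    · exact h
    · rw [← h] at hkn; norm_num at hkn; linarith
  obtain ⟨S, hS1, hSc, hSn⟩ := exists_net k
  have hN : LipschitzWith 1 (fun x : EE n => ‖x‖) := lipschitzWith_one_norm
  let s : ℝ := m/(5*b^2)
  let s' : ℝ := w/5
  let Φ : Fin 3 × EE k → (Fin k → EE n) → ℝ := fun i g =>
    if i.1 = 0 then s * (F (comb g i.2) - m) - Real.pi^2 * s^2 * (b.toNNReal:ℝ)^2/8
    else if i.1 = 1 then (-s) * (F (comb g i.2) - m) - Real.pi^2 * (-s)^2 * (b.toNNReal:ℝ)^2/8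
    else s' * (‖comb g i.2‖ - q) - Real.pi^2 * s'^2 * ((1:NNReal):ℝ)^2/8
  have hFc := hF.continuous
  have hlaw : ∀ y, ‖y‖ = 1 → ∀ H : EE n → ENNReal, Measurable H →
      ∫⁻ g, H (comb g y) ∂(Measure.pi (fun _ : Fin k => stdGaussian (EE n))) =
      ∫⁻ x, H x ∂(stdGaussian (EE n)) := by
    intro y hy H hH
    have := lintegral_map (μ := Measure.pi (fun _ : Fin k => stdGaussian (EE n))) hH (comb_cont (n:=n) y).measurable
    rw [comb_law k n y hy] at this
    exact this.symm
  obtain ⟨g, hg⟩ := exists_good (Measure.pi (fun _ : Fin k => stdGaussian (EE n)))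
    (Finset.univ ×ˢ S) Φ
    (by
      rintro ⟨i, y⟩ -
      have := comb_cont (n := n) y
      fin_cases i <;> simp [Φ] <;> fun_prop)
    (by
      rintro ⟨i, y⟩ hi
      have hy : ‖y‖ = 1 := hS1 y (by simpa using hi)
      have a1 := conc_mgf1 n hF s
      have a2 := conc_mgf1 n hF (-s)
      have a3 := conc_mgf1 n hN s'
      rw [← hlaw y hy _ (by fun_prop)] at a1 a2 a3
      fin_cases i
      · exact a1
      · exact a2
      · exact a3)
  have hcard : (((Finset.univ : Finset (Fin 3)) ×ˢ S).card : ℝ) ≤ Real.exp (4*k) := by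
    rw [Finset.card_product]
    push_cast
    refine le_trans ?_ (card_exp k hk)
    simp
    exact_mod_cast hSc
  have hpi : Real.pi^2/8 ≤ 1.25 := by nlinarith [Real.pi_lt_d2, Real.pi_pos]
  have hbb : (b.toNNReal:ℝ) = b := Real.coe_toNNReal _ hb.le
  have hs0 : 0 < s := by positivity
  have hs'0 : 0 < s' := by positivity
  have hsb : Real.pi^2 * s^2 * b^2/8 ≤ 1.25 * (s * m / 5) := by
    have e : s^2 * b^2 = s * m/5 := by simp only [s]; field_simp
    have : Real.pi^2 * s^2 * b^2/8 = Real.pi^2/8 * (s^2*b^2) := by ring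
    rw [this, e]
    exact mul_le_mul_of_nonneg_right hpi (by positivity)
  have h4k : 4 * (k:ℝ) ≤ s * m /4 := by
    have e : s * m / 4 = m^2/(20*b^2) := by simp only [s]; field_simp; norm_num
    rw [e, le_div_iff₀ (by positivity)]
    linarith
  have hsb' : Real.pi^2 * s'^2/8 ≤ 1.25 * (s' * w / 5) := by
    have : Real.pi^2 * s'^2/8 = Real.pi^2/8 * (s' * w/5) := by simp only [s']; ring
    rw [this]
    exact mul_le_mul_of_nonneg_right hpi (by positivity)
  have h4k' : 4 * (k:ℝ) ≤ s' * w /4 := by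
    simp only [s']; nlinarith
  have net : ∀ y ∈ S, m/2 ≤ F (comb g y) ∧ F (comb g y) ≤ 3/2 * m ∧ ‖comb g y‖ ≤ 3/2 * w := by
    intro y hy
    have b1 := rearr_exp (hg (0, y) (by simpa using hy)) hcard
    have b2 := rearr_exp (hg (1, y) (by simpa using hy)) hcard
    have b3 := rearr_exp (hg (2, y) (by simpa using hy)) hcard
    simp only [Φ, hbb, NNReal.coe_one] at b1 b2 b3
    simp at b1 b2 b3
    refine ⟨?_, ?_, ?_⟩
    · have : s * (m - F (comb g y)) ≤ s * (m/2) := by nlinarith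
      linarith [le_of_mul_le_mul_left this hs0]
    · have : s * (F (comb g y) - m) ≤ s * (m/2) := by nlinarith
      linarith [le_of_mul_le_mul_left this hs0]
    · have : s' * (‖comb g y‖ - q) ≤ s' * (w/2) := by nlinarith
      linarith [le_of_mul_le_mul_left this hs'0]
  -- pass from the net to the sphere
  have sup_bound : ∀ (H : EE n → ℝ) (B A : ℝ), 0 ≤ B → 0 ≤ A → (∀ x y, H (x+y) ≤ H x + H y) →
      (∀ (a : ℝ) x, H (a • x) = |a| * H x) → (∀ x, H x ≤ B * ‖x‖) → (∀ y ∈ S, H (comb g y) ≤ A) →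
      ∀ y, H (comb g y) ≤ 8/7 * A * ‖y‖ := by
    intro H B A hB hA h1 h2 h3 h4
    -- the iterated bound
    have hfin : ∃ R, 0 ≤ R ∧ ∀ y, H (comb g y) ≤ R * ‖y‖ := by
      refine ⟨B * ∑ j, ‖g j‖, by positivity, fun y => (h3 _).trans ?_⟩
      rw [mul_assoc]
      refine mul_le_mul_of_nonneg_left ?_ hB
      rw [comb, Finset.sum_mul]
      refine (norm_sum_le _ _).trans (Finset.sum_le_sum fun j _ => ?_)
      rw [norm_smul, mul_comm]
      exact mul_le_mul_of_nonneg_left (PiLp.norm_apply_le y j) (norm_nonneg _)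
    have hstep : ∀ R, 0 ≤ R → (∀ y, H (comb g y) ≤ R * ‖y‖) → ∀ y, H (comb g y) ≤ (A + R/8) * ‖y‖ := by
      intro R hR hRy y
      rcases eq_or_ne y 0 with rfl | hy
      · simpa using hRy 0
      have hyn : 0 < ‖y‖ := norm_pos_iff.2 hy
      have hu : ‖(‖y‖⁻¹ • y)‖ = 1 := by rw [norm_smul, norm_inv, norm_norm]; field_simp
      obtain ⟨z, hz, hyz⟩ := hSn _ hu
      have e1 : H (comb g (‖y‖⁻¹ • y)) ≤ A + R/8 := by
        have := h1 (comb g z) (comb g (‖y‖⁻¹ • y - z))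
        rw [← comb_add, add_sub_cancel] at this
        have h5 := hRy (‖y‖⁻¹ • y - z)
        have h6 := mul_le_mul_of_nonneg_left hyz hR
        linarith [h4 z hz]
      have e2 : y = ‖y‖ • (‖y‖⁻¹ • y) := by rw [smul_smul]; field_simp; simp
      rw [e2, comb_smul, h2, abs_norm, ← e2, mul_comm]
      exact mul_le_mul_of_nonneg_right e1 hyn.le
    obtain ⟨R, hR, hRy⟩ := hfin
    have hit : ∀ i : ℕ, ∀ y, H (comb g y) ≤ (8/7*A + R * (1/8)^i) * ‖y‖ := by
      intro i
      induction i with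
      | zero => 
        intro y
        refine (hRy y).trans (mul_le_mul_of_nonneg_right ?_ (norm_nonneg _))
        simp; positivity
      | succ i ih =>
        intro y
        refine (hstep _ (by positivity) ih y).trans (mul_le_mul_of_nonneg_right ?_ (norm_nonneg _))
        rw [pow_succ]; linarith
    intro y
    have hlim : Filter.Tendsto (fun i : ℕ => (8/7*A + R * (1/8:ℝ)^i) * ‖y‖) Filter.atTop
        (nhds ((8/7*A + R * 0) * ‖y‖)) :=
      ((tendsto_const_nhds).add ((tendsto_pow_atTop_nhds_zero_of_lt_one (by norm_num)
        (by norm_num)).const_mul R)).mul_const _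
    simpa using ge_of_tendsto' hlim (fun i => hit i y)
  have hFup := sup_bound F b (3/2*m) hb.le (by positivity) hadd hsm hle (fun y hy => (net y hy).2.1)
  have hNup := sup_bound (fun x => ‖x‖) 1 (3/2*w) (by norm_num) (by positivity) norm_add_le
    (fun a x => by simp [norm_smul]) (by simp) (fun y hy => (net y hy).2.2)
  refine ⟨g, fun y => ⟨?_, ?_⟩⟩
  · rcases eq_or_ne y 0 with rfl | hy
    · have : comb g 0 = (0:ℝ) • (0 : EE n) := by simp [comb]
      rw [this, hsm]; simp
    have hyn : 0 < ‖y‖ := norm_pos_iff.2 hy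
    have hu : ‖(‖y‖⁻¹ • y)‖ = 1 := by rw [norm_smul, norm_inv, norm_norm]; field_simp
    obtain ⟨z, hz, hyz⟩ := hSn _ hu
    have e1 : 1/4 * m ≤ F (comb g (‖y‖⁻¹ • y)) := by
      have := hadd (comb g (‖y‖⁻¹ • y)) (comb g (z - ‖y‖⁻¹ • y))
      rw [← comb_add, add_sub_cancel] at this
      have h5 := hFup (z - ‖y‖⁻¹ • y)
      rw [norm_sub_rev] at hyz
      have h6 := mul_le_mul_of_nonneg_left hyz (show 0 ≤ 8/7 * (3/2*m) by positivity)
      have := (net z hz).1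
      linarith
    have e2 : y = ‖y‖ • (‖y‖⁻¹ • y) := by rw [smul_smul]; field_simp; simp
    rw [e2, comb_smul, hsm, abs_norm, ← e2, mul_comm]
    exact mul_le_mul_of_nonneg_left e1 hyn.le
  · refine (hNup y).trans (mul_le_mul_of_nonneg_right ?_ (norm_nonneg _))
    linarith

open ProbabilityTheory

lemma hasFDerivAt_expInt {n : ℕ} {G : Type*} [NormedAddCommGroup G] [NormedSpace ℝ G]
    {K : Set (EE n)} (hK : IsCompact K) {u : EE n → G} (hu : Continuous u) (y₀ : EE n) :
    HasFDerivAt (fun y => ∫ x in K, Real.exp (inner ℝ x y) • u x)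
      (∫ x in K, (Real.exp (inner ℝ x y₀) • (innerSL ℝ x).smulRight (u x))) y₀ := by
  obtain ⟨R, hR⟩ := hK.isBounded.exists_norm_le
  obtain ⟨U, hU⟩ := (hK.image hu).isBounded.exists_norm_le
  have hKm := hK.measurableSet
  have hfin : IsFiniteMeasure (volume.restrict K) := ⟨by simpa using hK.measure_lt_top⟩
  have hc : Continuous fun x : EE n => (innerSL ℝ x).smulRight (u x) := by
    have : Continuous fun x : EE n => ContinuousLinearMap.smulRightL ℝ (EE n) G (innerSL ℝ x) (u x) := by
      fun_prop
    exact this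
  have hR0 : ∀ x ∈ K, 0 ≤ R := fun x hx => (norm_nonneg x).trans (hR x hx)
  refine hasFDerivAt_integral_of_dominated_of_fderiv_le
    (F := fun y x => Real.exp (inner ℝ x y) • u x)
    (F' := fun y x => Real.exp (inner ℝ x y) • (innerSL ℝ x).smulRight (u x))
    (bound := fun _ => Real.exp (R * (‖y₀‖ + 1)) * (R * U)) (ball_mem_nhds y₀ one_pos) ?_ ?_ ?_ ?_ ?_ ?_
  · refine Filter.Eventually.of_forall fun y => ?_
    exact ((by fun_prop : Continuous fun x : EE n => Real.exp (inner ℝ x y) • u x).continuousOn).aestronglyMeasurable hKm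
  · exact ((by fun_prop : Continuous fun x : EE n => Real.exp (inner ℝ x y₀) • u x).continuousOn).integrableOn_compact hK
  · exact ((by fun_prop : Continuous fun x : EE n => Real.exp (inner ℝ x y₀) • (innerSL ℝ x).smulRight (u x)).continuousOn).aestronglyMeasurable hKm
  · refine (ae_restrict_iff' hKm).2 (Filter.Eventually.of_forall fun x hx y hy => ?_)
    have h1 : ‖y‖ ≤ ‖y₀‖ + 1 := by
      have := norm_sub_norm_le y y₀
      rw [mem_ball, dist_eq_norm] at hy
      linarith
    have h2 : inner ℝ x y ≤ R * (‖y₀‖ + 1) :=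
      (real_inner_le_norm x y).trans (mul_le_mul (hR x hx) h1 (norm_nonneg _) (hR0 x hx))
    have h3 := hU (u x) (mem_image_of_mem _ hx)
    have h0 := hR x hx
    have h00 := hR0 x hx
    rw [norm_smul, ContinuousLinearMap.norm_smulRight_apply, innerSL_apply_norm, Real.norm_eq_abs, Real.abs_exp]
    gcongr
  · exact integrable_const _
  · refine Filter.Eventually.of_forall fun x y _ => ?_
    have h1 : HasFDerivAt (fun y : EE n => inner ℝ x y) (innerSL ℝ x) y := (innerSL ℝ x).hasFDerivAt
    have := (h1.exp).smul_const (u x)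
    convert this using 1
    ext v
    simp [smul_smul]

open ProbabilityTheory

lemma gauss_box {n : ℕ} (u : OrthonormalBasis (Fin n) ℝ (EE n)) (l : Fin n → ℝ) (hl : ∀ i, 0 < l i) (μ0 : EE n) :
    ∫⁻ x, ENNReal.ofReal (Real.exp (-(1/2) * ∑ i, (inner ℝ (u i) (x - μ0))^2 / l i)) ∂(volume : Measure (EE n))
     = ENNReal.ofReal (∏ i, √(2 * Real.pi * l i)) := by
  have e1 : MeasurePreserving (fun x : EE n => x - μ0) volume volume := measurePreserving_sub_right volume μ0
  have e2 := u.measurePreserving_repr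
  have e3 := PiLp.volume_preserving_ofLp (Fin n)
  have e4 := (e3.comp e2).comp e1
  have hi : ∀ i, Integrable (fun t : ℝ => Real.exp (-(1/(2*l i)) * t^2)) :=
    fun i => integrable_exp_neg_mul_sq (by have := hl i; positivity)
  have hI : Integrable (fun z : Fin n → ℝ => ∏ i, Real.exp (-(1/(2*l i)) * (z i)^2)) :=
    Integrable.fintype_prod hi
  have h1 : ∫⁻ x, ENNReal.ofReal (Real.exp (-(1/2) * ∑ i, (inner ℝ (u i) (x - μ0))^2 / l i)) ∂(volume : Measure (EE n))
     = ∫⁻ z : Fin n → ℝ, ENNReal.ofReal (∏ i, Real.exp (-(1/(2*l i)) * (z i)^2)) := by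
    rw [← e4.lintegral_comp (by fun_prop)]
    congr 1; ext x; congr 1
    rw [← Real.exp_sum]
    congr 1
    rw [Finset.mul_sum]
    refine Finset.sum_congr rfl fun i _ => ?_
    have := (hl i).ne'
    simp only [Function.comp, u.repr_apply_apply]
    field_simp
  rw [h1, ← ofReal_integral_eq_lintegral_ofReal hI (Filter.Eventually.of_forall fun z => by positivity)]
  congr 1
  rw [integral_fintype_prod_volume_eq_prod (fun i (t:ℝ) => Real.exp (-(1/(2*l i)) * t^2))]
  refine Finset.prod_congr rfl fun i _ => ?_
  rw [integral_gaussian]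
  congr 1
  field_simp

lemma det_cov {n : ℕ} (p : Measure (EE n)) [IsProbabilityMeasure p] (A : ℝ) (hA : 0 < A)
    (hp : p ≤ ENNReal.ofReal A • volume) (S : EE n →L[ℝ] EE n) (μ0 : EE n)
    (hS : ∀ h h', inner ℝ (S h) h' = ∫ x, inner ℝ h (x - μ0) * inner ℝ h' (x - μ0) ∂p)
    (hint : ∀ h, Integrable (fun x => (inner ℝ h (x - μ0))^2) p)
    (hpos : ∀ h, h ≠ 0 → 0 < inner ℝ (S h) h) :
    1 ≤ A^2 * (2 * Real.pi * Real.exp 1)^n * S.det := by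
  have hsym : (S : EE n →ₗ[ℝ] EE n).IsSymmetric := by
    intro a b
    change inner ℝ (S a) b = inner ℝ a (S b)
    rw [real_inner_comm (S b) a, hS, hS]
    simp_rw [mul_comm]
  have hn : Module.finrank ℝ (EE n) = n := by simp
  set u := hsym.eigenvectorBasis hn
  set l := hsym.eigenvalues hn
  have hl' : ∀ i, inner ℝ (S (u i)) (u i) = l i := by
    intro i
    have : S (u i) = l i • u i := hsym.apply_eigenvectorBasis hn i
    rw [this, inner_smul_left]
    simp
  have hl : ∀ i, 0 < l i := fun i => by
    rw [← hl' i]; exact hpos _ (u.orthonormal.ne_zero i)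
  have hdet : S.det = ∏ i, l i := hsym.det_eq_prod_eigenvalues hn
  set Q : EE n → ℝ := fun x => -(1/2) * ∑ i, (inner ℝ (u i) (x - μ0))^2 / l i with hQ
  have hQint : Integrable Q p := by
    apply Integrable.const_mul
    exact integrable_finsetSum _ fun i _ => (hint (u i)).div_const _
  have hQI : ∫ x, Q x ∂p = -(n/2 : ℝ) := by
    rw [hQ, integral_const_mul, integral_finsetSum _ fun i _ => (hint (u i)).div_const _]
    have : ∀ i, ∫ x, (inner ℝ (u i) (x - μ0))^2 / l i ∂p = 1 := by
      intro i
      rw [integral_div]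
      have h2 := hl' i
      rw [hS] at h2
      simp_rw [← sq] at h2
      rw [h2, div_self (hl i).ne']
    simp [this]
    ring
  have hQc : Continuous Q := by fun_prop
  have hQ0 : ∀ x, Q x ≤ 0 := by
    intro x
    have : 0 ≤ ∑ i, (inner ℝ (u i) (x - μ0))^2 / l i :=
      Finset.sum_nonneg fun i _ => by have := hl i; positivity
    simp only [hQ]; linarith
  have hei : Integrable (fun x => Real.exp (Q x)) p := by
    refine Integrable.of_bound (by fun_prop) 1 (Filter.Eventually.of_forall fun x => ?_)
    rw [Real.norm_eq_abs, Real.abs_exp]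
    exact Real.exp_le_one_iff.2 (hQ0 x)
  have hJ : Real.exp (∫ x, Q x ∂p) ≤ ∫ x, Real.exp (Q x) ∂p :=
    convexOn_exp.map_integral_le Real.continuous_exp.continuousOn isClosed_univ
      (by simp) hQint hei
  rw [hQI] at hJ
  have hU : ENNReal.ofReal (∫ x, Real.exp (Q x) ∂p) ≤ ENNReal.ofReal (A * ∏ i, √(2 * Real.pi * l i)) := by
    rw [ofReal_integral_eq_lintegral_ofReal hei (Filter.Eventually.of_forall fun z => by positivity),
      ENNReal.ofReal_mul hA.le, ← gauss_box u l hl μ0, ← lintegral_const_mul' _ _ (by simp)]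
    refine (lintegral_mono' hp le_rfl).trans ?_
    rw [lintegral_smul_measure, lintegral_const_mul' _ _ (by simp)]
    rfl
  rw [ENNReal.ofReal_le_ofReal_iff (by positivity)] at hU
  have h3 := hJ.trans hU
  have h4 := pow_le_pow_left₀ (by positivity) h3 2
  rw [mul_pow, ← Finset.prod_pow] at h4
  have h5 : ∏ i, √(2 * Real.pi * l i) ^ 2 = (2 * Real.pi)^n * S.det := by
    rw [hdet]
    rw [Finset.prod_congr rfl fun i _ => Real.sq_sqrt (by have := hl i; positivity), Finset.prod_mul_distrib]
    simp
  rw [h5, ← Real.exp_nat_mul] at h4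
  have h6 : ((2:ℕ):ℝ) * -(n/2:ℝ) = -n := by push_cast; ring
  rw [h6, Real.exp_neg] at h4
  have h7 : Real.exp 1 ^ n = Real.exp n := by rw [← Real.exp_nat_mul]; simp
  rw [mul_pow, h7]
  rw [inv_le_iff_one_le_mul₀ (by positivity)] at h4
  linarith

open ProbabilityTheory

def tl {n : ℕ} (K : Set (EE n)) (y : EE n) : Measure (EE n) :=
  (volume.restrict K).tilted (fun x => inner ℝ x y)

def tZ {n : ℕ} (K : Set (EE n)) (y : EE n) : ℝ := ∫ x in K, Real.exp (inner ℝ x y)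

lemma tZ_pos {n : ℕ} {K : Set (EE n)} (hK : IsCompact K) (hv : volume K ≠ 0) (y : EE n) : 0 < tZ K y := by
  have : NeZero (volume.restrict K) := ⟨by simpa using hv⟩
  exact integral_exp_pos
    ((by fun_prop : Continuous fun x : EE n => Real.exp (inner ℝ x y)).continuousOn.integrableOn_compact hK)

lemma tl_prob {n : ℕ} {K : Set (EE n)} (hK : IsCompact K) (hv : volume K ≠ 0) (y : EE n) :
    IsProbabilityMeasure (tl K y) := by
  have : NeZero (volume.restrict K) := ⟨by simpa using hv⟩
  exact isProbabilityMeasure_tilted 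
    ((by fun_prop : Continuous fun x : EE n => Real.exp (inner ℝ x y)).continuousOn.integrableOn_compact hK)

lemma tl_ae {n : ℕ} {K : Set (EE n)} (hK : IsCompact K) (y : EE n) : ∀ᵐ x ∂(tl K y), x ∈ K :=
  (tilted_absolutelyContinuous _ _).ae_le (ae_restrict_mem hK.measurableSet)

lemma tl_integrable {n : ℕ} {G : Type*} [NormedAddCommGroup G] [NormedSpace ℝ G] [SecondCountableTopology G]
    [MeasurableSpace G] [BorelSpace G]
    {K : Set (EE n)} (hK : IsCompact K) (hv : volume K ≠ 0) (y : EE n)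
    {u : EE n → G} (hu : Continuous u) : Integrable u (tl K y) := by
  have := tl_prob hK hv y
  obtain ⟨U, hU⟩ := (hK.image hu).isBounded.exists_norm_le
  refine Integrable.of_bound hu.aestronglyMeasurable U ?_
  filter_upwards [tl_ae hK y] with x hx
  exact hU _ (mem_image_of_mem _ hx)

lemma tl_int {n : ℕ} {G : Type*} [NormedAddCommGroup G] [NormedSpace ℝ G]
    (K : Set (EE n)) (y : EE n) (u : EE n → G) :
    ∫ x, u x ∂(tl K y) = (tZ K y)⁻¹ • ∫ x in K, Real.exp (inner ℝ x y) • u x := by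
  rw [tl, integral_tilted, ← integral_smul]
  congr 1; ext x
  rw [smul_smul, div_eq_inv_mul]; rfl

def tB {n : ℕ} (K : Set (EE n)) (y : EE n) : EE n := ∫ x, x ∂(tl K y)

lemma tB_deriv {n : ℕ} {K : Set (EE n)} (hK : IsCompact K) (hv : volume K ≠ 0) (y : EE n) :
    ∃ S : EE n →L[ℝ] EE n, HasFDerivAt (tB K) S y ∧
      ∀ h h', inner ℝ (S h) h' = ∫ x, inner ℝ h (x - tB K y) * inner ℝ h' (x - tB K y) ∂(tl K y) := by
  have hZ : HasFDerivAt (tZ K) (∫ x in K, Real.exp (inner ℝ x y) • innerSL ℝ x) y := by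
    have := hasFDerivAt_expInt hK (continuous_const (y := (1:ℝ))) y
    have e : ∀ x : EE n, (innerSL ℝ x).smulRight (1:ℝ) = innerSL ℝ x := by
      intro x; ext v; simp
    simp only [e, smul_eq_mul, mul_one] at this
    exact this
  have hV := hasFDerivAt_expInt hK continuous_id y
  have hZ0 := tZ_pos hK hv y
  have hB : tB K = fun y => (tZ K y)⁻¹ • ∫ x in K, Real.exp (inner ℝ x y) • x := by
    ext1 y; exact tl_int K y _
  have hD := ((hasDerivAt_inv hZ0.ne').comp_hasFDerivAt y hZ).smul hV
  refine ⟨_, (by rw [hB]; exact hD), ?_⟩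
  intro h h'
  have := tl_prob hK hv y
  set m := tB K y with hm
  have hm1 : ∀ a, ∫ x, inner ℝ a x ∂(tl K y) = inner ℝ a m := fun a =>
    integral_inner (tl_integrable hK hv y continuous_id) a
  have i1 : Integrable (fun x => inner ℝ h x * inner ℝ h' x) (tl K y) := tl_integrable hK hv y (by fun_prop)
  have i2 : ∀ a, Integrable (fun x => inner ℝ a x) (tl K y) := fun a => tl_integrable hK hv y (by fun_prop)
  have e1 : ∫ x, inner ℝ h (x - m) * inner ℝ h' (x - m) ∂(tl K y) =
      ∫ x, inner ℝ h x * inner ℝ h' x ∂(tl K y) - inner ℝ h m * inner ℝ h' m := by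
    have : ∀ x, inner ℝ h (x - m) * inner ℝ h' (x - m) = inner ℝ h x * inner ℝ h' x
        - inner ℝ h' m * inner ℝ h x - inner ℝ h m * inner ℝ h' x + inner ℝ h m * inner ℝ h' m := by
      intro x; rw [inner_sub_right, inner_sub_right]; ring
    simp_rw [this]
    have q1 : Integrable (fun x => inner ℝ h x * inner ℝ h' x - inner ℝ h' m * inner ℝ h x) (tl K y) :=
      i1.sub ((i2 _).const_mul _)
    have q2 : Integrable (fun x => inner ℝ h x * inner ℝ h' x - inner ℝ h' m * inner ℝ h x
        - inner ℝ h m * inner ℝ h' x) (tl K y) := q1.sub ((i2 _).const_mul _)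
    rw [integral_add q2 (integrable_const _),
      integral_sub q1 ((i2 _).const_mul _), integral_sub i1 ((i2 _).const_mul _),
      integral_const_mul, integral_const_mul, hm1, hm1]
    simp
    ring
  rw [e1]
  have hc : Continuous fun x : EE n => (innerSL ℝ x).smulRight x := by
    have : Continuous fun x : EE n => ContinuousLinearMap.smulRightL ℝ (EE n) (EE n) (innerSL ℝ x) x := by
      fun_prop
    exact this
  have j1 : Integrable (fun x : EE n => Real.exp (inner ℝ x y) • (innerSL ℝ x).smulRight x) (volume.restrict K) :=
    (by fun_prop : Continuous fun x : EE n => Real.exp (inner ℝ x y) • (innerSL ℝ x).smulRight x).continuousOn.integrableOn_compact hK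
  have j2 : Integrable (fun x : EE n => Real.exp (inner ℝ x y) • (innerSL ℝ x)) (volume.restrict K) :=
    (by fun_prop : Continuous fun x : EE n => Real.exp (inner ℝ x y) • (innerSL ℝ x)).continuousOn.integrableOn_compact hK
  have k1 : (∫ x in K, Real.exp (inner ℝ x y) • innerSL ℝ x) h = tZ K y * inner ℝ h m := by
    rw [ContinuousLinearMap.integral_apply j2, ← hm1, tl_int, smul_eq_mul, mul_inv_cancel_left₀ hZ0.ne']
    simp [real_inner_comm]
  have k2 : inner ℝ ((∫ x in K, Real.exp (inner ℝ x y) • (innerSL ℝ x).smulRight x) h) h' =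
      tZ K y * ∫ x, inner ℝ h x * inner ℝ h' x ∂(tl K y) := by
    rw [ContinuousLinearMap.integral_apply j1, real_inner_comm, ← integral_inner (j1.apply_continuousLinearMap h), tl_int, smul_eq_mul, mul_inv_cancel_left₀ hZ0.ne']
    simp [real_inner_comm, inner_smul_right]
  have k3 : ∫ x in K, Real.exp (inner ℝ x y) • x = tZ K y • m := by
    rw [hm, tB, tl_int, smul_smul, mul_inv_cancel₀ hZ0.ne', one_smul]
  have k4 : inner ℝ m h' = inner ℝ h' m := real_inner_comm _ _
  simp only [id] at k2 ⊢
  simp [inner_add_left, inner_smul_left, k1, k2, k3, k4]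
  field_simp
  ring

open ProbabilityTheory

lemma tl_pos {n : ℕ} {K : Set (EE n)} (hK : IsCompact K) (hv : volume K ≠ 0) (y : EE n) (m h : EE n) (hh : h ≠ 0) :
    0 < ∫ x, inner ℝ h (x - m) * inner ℝ h (x - m) ∂(tl K y) := by
  have hn : 0 ≤ ∫ x, inner ℝ h (x - m) * inner ℝ h (x - m) ∂(tl K y) :=
    integral_nonneg fun x => mul_self_nonneg _
  refine lt_of_le_of_ne hn fun h0 => hv ?_
  have hi : Integrable (fun x => inner ℝ h (x - m) * inner ℝ h (x - m)) (tl K y) :=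
    tl_integrable hK hv y (by fun_prop)
  have h1 := (integral_eq_zero_iff_of_nonneg (fun x => mul_self_nonneg _) hi).1 h0.symm
  have hac : volume.restrict K ≪ tl K y :=
    absolutelyContinuous_tilted 
      ((by fun_prop : Continuous fun x : EE n => Real.exp (inner ℝ x y)).continuousOn.integrableOn_compact hK)
  have h2 := hac.ae_le h1
  set P : AffineSubspace ℝ (EE n) := AffineSubspace.mk' m (LinearMap.ker (innerSL ℝ h : EE n →L[ℝ] ℝ).toLinearMap)
  have hP : P ≠ ⊤ := by
    intro hP
    have : m + h ∈ P := by rw [hP]; trivial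
    rw [AffineSubspace.mem_mk'] at this
    simp at this
    exact hh this
  have h3 := Measure.addHaar_affineSubspace volume P hP
  have h4 : ∀ᵐ x ∂(volume.restrict K), x ∈ (P : Set (EE n)) := by
    filter_upwards [h2] with x hx
    have hx' : inner ℝ h (x - m) = 0 := by simpa using hx
    change x ∈ P
    rw [AffineSubspace.mem_mk']
    simpa using hx'
  rw [ae_restrict_iff' hK.measurableSet] at h4
  have h5 : ∀ᵐ x ∂(volume : Measure (EE n)), x ∉ (P : Set (EE n)) := measure_eq_zero_iff_ae_notMem.1 h3
  refine measure_eq_zero_iff_ae_notMem.2 ?_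
  filter_upwards [h4, h5] with x a b c
  exact b (a c)

lemma tl_le {n : ℕ} {K : Set (EE n)} (hK : IsCompact K) (hv : volume K ≠ 0) (y : EE n) (a : ℝ)
    (ha : ∀ x ∈ K, |inner ℝ x y| ≤ a) :
    tl K y ≤ ENNReal.ofReal (Real.exp (2*a) / (volume K).toReal) • volume := by
  have hvp : 0 < (volume K).toReal := ENNReal.toReal_pos hv hK.measure_lt_top.ne
  have hint : IntegrableOn (fun x => Real.exp (inner ℝ x y)) K :=
    ((by fun_prop : Continuous fun x : EE n => Real.exp (inner ℝ x y)).continuousOn.integrableOn_compact hK)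
  have hZ : (volume K).toReal * Real.exp (-a) ≤ tZ K y := by
    have : ∫ x in K, Real.exp (-a) ≤ tZ K y := by
      refine setIntegral_mono_on (integrableOn_const hK.measure_lt_top.ne) hint hK.measurableSet ?_
      intro x hx
      exact Real.exp_le_exp.2 (neg_le_of_abs_le (ha x hx))
    simpa [Measure.real] using this
  refine Measure.le_iff.2 fun s hs => ?_
  rw [tl, tilted_apply' _ _ hs]
  have h1 : ∀ᵐ x ∂((volume.restrict K).restrict s), x ∈ K := ae_restrict_of_ae (ae_restrict_mem hK.measurableSet)
  calc _ ≤ ∫⁻ x in s, ENNReal.ofReal (Real.exp (2*a) / (volume K).toReal) ∂(volume.restrict K) := by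
        apply lintegral_mono_ae
        filter_upwards [h1] with x hx
        apply ENNReal.ofReal_le_ofReal
        change _ / tZ K y ≤ _
        rw [div_le_div_iff₀ (tZ_pos hK hv y) hvp]
        have h2 : Real.exp (inner ℝ x y) ≤ Real.exp a := Real.exp_le_exp.2 (le_of_abs_le (ha x hx))
        calc Real.exp (inner ℝ x y) * (volume K).toReal ≤ Real.exp a * (volume K).toReal := by gcongr
          _ = Real.exp (2*a) * ((volume K).toReal * Real.exp (-a)) := by
            rw [mul_comm (volume K).toReal, ← mul_assoc, ← Real.exp_add]; ring_nf
          _ ≤ _ := by gcongr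
    _ ≤ _ := by
        rw [setLIntegral_const]
        simp only [Measure.smul_apply, smul_eq_mul]
        gcongr
        exact Measure.restrict_le_self

lemma tB_inj {n : ℕ} {K : Set (EE n)} (hK : IsCompact K) (hv : volume K ≠ 0) : Function.Injective (tB K) := by
  choose S hS1 hS2 using tB_deriv hK hv
  intro y z hyz
  by_contra hne
  set h := z - y with hh
  have h0 : h ≠ 0 := sub_ne_zero.2 (Ne.symm hne)
  set g : ℝ → ℝ := fun t => inner ℝ h (tB K (y + t • h))
  have hg : ∀ t, HasDerivAt g (inner ℝ h (S (y + t • h) h)) t := by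
    intro t
    have h1 : HasDerivAt (fun t : ℝ => y + t • h) h t := by
      simpa using ((hasDerivAt_id t).smul_const h).const_add y
    have h2 := (hS1 (y + t • h)).comp_hasDerivAt t h1
    exact ((innerSL ℝ h).hasFDerivAt.comp_hasDerivAt t h2)
  have hm : StrictMono g := strictMono_of_deriv_pos fun t => by
    rw [(hg t).deriv, real_inner_comm, hS2]
    exact tl_pos hK hv _ _ h h0
  have := hm (zero_lt_one' ℝ)
  simp [g, hh, hyz] at this

lemma santalo {n : ℕ} {K T : Set (EE n)} (hc : Convex ℝ K) (hK : IsCompact K) (hv : volume K ≠ 0)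
    (hT : MeasurableSet T) (hKT : ∀ x ∈ K, ∀ y ∈ T, |inner ℝ x y| ≤ n) :
    (volume K).toReal * (volume T).toReal ≤ (2 * Real.pi * Real.exp 5)^n := by
  choose S hS1 hS2 using tB_deriv hK hv
  have hvp : 0 < (volume K).toReal := ENNReal.toReal_pos hv hK.measure_lt_top.ne
  have h1 := lintegral_abs_det_fderiv_eq_addHaar_image volume hT
    (fun x hx => (hS1 x).hasFDerivWithinAt) (tB_inj hK hv).injOn
  have h2 : volume (tB K '' T) ≤ volume K := by
    apply measure_mono
    rintro _ ⟨y, -, rfl⟩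
    have := tl_prob hK hv y
    exact hc.integral_mem hK.isClosed (tl_ae hK y) (tl_integrable hK hv y continuous_id)
  set A : ℝ := Real.exp (2*n) / (volume K).toReal with hA
  have hA0 : 0 < A := by positivity
  have h3 : ∀ y ∈ T, (A^2 * (2 * Real.pi * Real.exp 1)^n)⁻¹ ≤ |(S y).det| := by
    intro y hy
    have := tl_prob hK hv y
    have := det_cov (tl K y) A hA0 (tl_le hK hv y n (fun x hx => hKT x hx y hy)) (S y) (tB K y) (hS2 y)
      (fun h => tl_integrable hK hv y (by fun_prop))
      (fun h hh => by rw [hS2]; exact tl_pos hK hv _ _ h hh)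
    rw [inv_le_iff_one_le_mul₀' (by positivity)]
    exact this.trans (by gcongr; exact le_abs_self _)
  have h4 : ENNReal.ofReal ((A^2 * (2 * Real.pi * Real.exp 1)^n)⁻¹) * volume T ≤ volume K := by
    rw [← setLIntegral_const]
    refine le_trans ?_ (h1.le.trans h2)
    apply setLIntegral_mono' hT
    intro y hy
    exact ENNReal.ofReal_le_ofReal (h3 y hy)
  have h5 := ENNReal.toReal_mono hK.measure_lt_top.ne h4
  rw [ENNReal.toReal_mul, ENNReal.toReal_ofReal (by positivity), inv_mul_le_iff₀ (by positivity), hA] at h5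
  have h6 : (2 * Real.pi * Real.exp 5)^n = Real.exp (2*n)^2 * (2 * Real.pi * Real.exp 1)^n := by
    rw [mul_pow, mul_pow _ (Real.exp 1), ← Real.exp_nat_mul, ← Real.exp_nat_mul, ← Real.exp_nat_mul, mul_comm (Real.exp _), mul_assoc, ← Real.exp_add]
    congr 2; push_cast; ring
  rw [h6]
  set v := (volume K).toReal
  have : v * (volume T).toReal ≤ v * ((Real.exp (2 * n) / v) ^ 2 * (2 * Real.pi * Real.exp 1) ^ n * v) := by gcongr
  refine this.trans (le_of_eq ?_)
  field_simp

open ProbabilityTheory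

lemma body_nhds {n : ℕ} {K : Set (EE n)} (h : IsSymmetricConvexBody K) : K ∈ nhds (0 : EE n) := by
  obtain ⟨hc, hK, ⟨x, hx⟩, hs⟩ := h
  rw [_root_.mem_nhds_iff]
  refine ⟨interior K, interior_subset, isOpen_interior, ?_⟩
  have hx' : -x ∈ interior K := by
    have e : -interior K = interior (-K) := (Homeomorph.neg (EE n)).preimage_interior K
    rw [hs, ← e]
    simpa using hx
  have := hc.interior hx hx' (by norm_num : (0:ℝ) ≤ 1/2) (by norm_num : (0:ℝ) ≤ 1/2) (by norm_num)
  simpa using this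

lemma body_vol {n : ℕ} {K : Set (EE n)} (h : IsSymmetricConvexBody K) : volume K ≠ 0 :=
  (Measure.measure_pos_of_mem_nhds volume (body_nhds h)).ne'

lemma polar_isClosed {n : ℕ} (K : Set (EE n)) : IsClosed (polarSet K) := by
  have : polarSet K = ⋂ x ∈ K, {y : EE n | inner ℝ y x ≤ 1} := by ext; simp [polarSet]
  rw [this]
  refine isClosed_biInter fun x _ => isClosed_le (by fun_prop) (by fun_prop)

lemma polar_compact {n : ℕ} {K : Set (EE n)} (h : IsSymmetricConvexBody K) : IsCompact (polarSet K) := by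
  obtain ⟨ε, hε, hb⟩ := Metric.nhds_basis_closedBall.mem_iff.1 (body_nhds h)
  refine (isCompact_closedBall (0 : EE n) (1/ε)).of_isClosed_subset (polar_isClosed K) ?_
  intro y hy
  rw [mem_closedBall_zero_iff]
  by_cases h0 : y = 0
  · simp [h0]; positivity
  have h0' : 0 < ‖y‖ := norm_pos_iff.2 h0
  have := hy ((ε/‖y‖) • y) (hb (by rw [mem_closedBall_zero_iff, norm_smul]; simp [abs_of_pos hε, h0'.ne']))
  rw [inner_smul_right, real_inner_self_eq_norm_sq] at this
  rw [le_div_iff₀ hε]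
  have e : ε / ‖y‖ * ‖y‖^2 = ‖y‖ * ε := by field_simp
  linarith

lemma polar_nhds {n : ℕ} {K : Set (EE n)} (h : IsSymmetricConvexBody K) : polarSet K ∈ nhds (0 : EE n) := by
  obtain ⟨R, hR⟩ := h.2.1.isBounded.exists_norm_le
  rw [Metric.nhds_basis_closedBall.mem_iff]
  refine ⟨1/(|R|+1), by positivity, ?_⟩
  intro y hy x hx
  rw [mem_closedBall_zero_iff] at hy
  calc inner ℝ y x ≤ ‖y‖ * ‖x‖ := real_inner_le_norm _ _
    _ ≤ 1/(|R|+1) * (|R|+1) := by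
      gcongr
      have := hR x hx
      have := le_abs_self R
      linarith
    _ = 1 := by field_simp

lemma ball_vol_lower (n : ℕ) (hn : 1 ≤ n) :
    (2/√n)^n ≤ (volume (closedBall (0 : EE n) 1)).toReal := by
  have hn0 : (0:ℝ) < n := by exact_mod_cast hn
  have e3 := PiLp.volume_preserving_ofLp (Fin n)
  set C : Set (Fin n → ℝ) := Set.pi univ fun _ => Icc (-(1/√n)) (1/√n)
  have h1 : volume (WithLp.ofLp ⁻¹' C : Set (EE n)) = ENNReal.ofReal ((2/√n)^n) := by
    rw [e3.measure_preimage (MeasurableSet.univ_pi fun _ => measurableSet_Icc).nullMeasurableSet]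
    rw [volume_pi_pi]
    simp [Real.volume_Icc]
    rw [ENNReal.ofReal_pow (by positivity)]
    congr 2
    ring
  have h2 : (WithLp.ofLp ⁻¹' C : Set (EE n)) ⊆ closedBall 0 1 := by
    intro x hx
    rw [mem_closedBall_zero_iff, EuclideanSpace.norm_eq]
    rw [Real.sqrt_le_one]
    have hx' : ∀ i, |x i| ≤ 1/√n := fun i => abs_le.2 (hx i (mem_univ i))
    calc ∑ i, ‖x i‖^2 ≤ ∑ i : Fin n, (1/√n)^2 := by
          refine Finset.sum_le_sum fun i _ => ?_
          rw [Real.norm_eq_abs]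
          exact pow_le_pow_left₀ (abs_nonneg _) (hx' i) 2
      _ = 1 := by
          simp [Real.sq_sqrt hn0.le, hn0.ne']
  have h3 := measure_mono (μ := volume) h2
  rw [h1] at h3
  rwa [ENNReal.ofReal_le_iff_le_toReal (measure_closedBall_lt_top).ne] at h3

lemma volRadius_pos {n : ℕ} {K : Set (EE n)} (hK : IsCompact K) (hv : volume K ≠ 0) : 0 < volRadius K := by
  have := ENNReal.toReal_pos hv hK.measure_lt_top.ne
  have h2 : 0 < (volume (closedBall (0 : EE n) 1)).toReal :=
    ENNReal.toReal_pos (measure_closedBall_pos volume _ one_pos).ne' (measure_closedBall_lt_top).ne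
  unfold volRadius
  positivity

lemma volRadius_mul {n : ℕ} (hn : 1 ≤ n) {K : Set (EE n)} (h : IsSymmetricConvexBody K) :
    volRadius K * volRadius (polarSet K) ≤ Real.pi * Real.exp 5 / 2 := by
  have hn0 : (0:ℝ) < n := by exact_mod_cast hn
  have hsan := santalo (T := (n:ℝ) • polarSet K) h.1 h.2.1 (body_vol h)
    ((polar_isClosed K).measurableSet.const_smul₀ _) (by
      rintro x hx _ ⟨y, hy, rfl⟩
      simp only [inner_smul_right]
      rw [abs_mul, abs_of_pos hn0]
      have h1 := hy x hx
      have h2 := hy (-x) (by rw [h.2.2.2] at hx; exact hx)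
      rw [inner_neg_right] at h2
      rw [real_inner_comm] at h1 h2
      have : |inner ℝ x y| ≤ 1 := abs_le.2 ⟨by linarith, h1⟩
      nlinarith)
  rw [Measure.addHaar_smul] at hsan
  simp only [finrank_euclideanSpace, Fintype.card_fin, ENNReal.toReal_mul] at hsan
  rw [ENNReal.toReal_ofReal (by positivity), abs_of_pos (by positivity)] at hsan
  have hD := ball_vol_lower n hn
  unfold volRadius
  set D := (volume (closedBall (0 : EE n) 1)).toReal
  set a := (volume K).toReal
  set c := (volume (polarSet K)).toReal
  have ha : 0 ≤ a := ENNReal.toReal_nonneg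
  have hc : 0 ≤ c := ENNReal.toReal_nonneg
  have hD0 : 0 < D := lt_of_lt_of_le (by positivity) hD
  rw [← Real.mul_rpow (by positivity) (by positivity)]
  have key : a / D * (c / D) ≤ (Real.pi * Real.exp 5 / 2)^n := by
    rw [div_mul_div_comm, div_le_iff₀ (by positivity)]
    have h1 : (2/√n)^n * (2/√n)^n ≤ D * D := by gcongr
    have h2 : (2/√(n:ℝ))^n * (2/√n)^n = 4^n / (n:ℝ)^n := by
      rw [← mul_pow, div_mul_div_comm, Real.mul_self_sqrt hn0.le, div_pow]; norm_num
    rw [h2] at h1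
    have h3 : a * c ≤ (2 * Real.pi * Real.exp 5)^n / (n:ℝ)^n := by
      rw [le_div_iff₀ (by positivity)]; linarith
    refine h3.trans ?_
    calc (2 * Real.pi * Real.exp 5)^n / (n:ℝ)^n = (Real.pi * Real.exp 5 / 2)^n * (4^n / (n:ℝ)^n) := by
          rw [mul_div_assoc', ← mul_pow]; congr 2; ring
      _ ≤ _ := by gcongr
  calc _ ≤ ((Real.pi * Real.exp 5 / 2)^n) ^ ((1:ℝ)/n) := by gcongr
    _ = _ := by rw [one_div, Real.pow_rpow_inv_natCast (by positivity) (by omega)]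

open ProbabilityTheory

lemma gauss_polar (n : ℕ) (hn : 1 ≤ n) (F : EE n → ℝ) (hsm : ∀ (a : ℝ) x, F (a • x) = |a| * F x) :
    ∫ x, (F x)^2 ∂(stdGaussian (EE n)) = (∫ θ : sphere (0 : EE n) 1, (F θ)^2 ∂((volume : Measure (EE n)).toSphere)) *
      ∫ r : Ioi (0:ℝ), r.1^2 * ((2 * Real.pi) ^ (-(n:ℝ)/2) * Real.exp (-r.1^2/2)) ∂(Measure.volumeIoiPow (n-1)) := by
  have hnt : Nontrivial (EE n) := by
    have : Nonempty (Fin n) := ⟨⟨0, by omega⟩⟩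
    infer_instance
  rw [stdG_eq]
  have h0 : Measurable (fun x : EE n => ENNReal.ofReal (gDens n x)) :=
    (gDens_cont n).measurable.ennreal_ofReal
  rw [integral_withDensity_eq_integral_toReal_smul h0 (by simp)]
  have h1 : ∀ x : EE n, (ENNReal.ofReal (gDens n x)).toReal • (F x)^2 = gDens n x * (F x)^2 := by
    intro x; rw [ENNReal.toReal_ofReal (gDens_pos n x).le]; rfl
  simp_rw [h1]
  calc ∫ x, gDens n x * (F x)^2 = ∫ x : ({(0 : EE n)}ᶜ : Set (EE n)), gDens n x.1 * (F x.1)^2 ∂(volume.comap Subtype.val) := by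
        rw [integral_subtype_comap (measurableSet_singleton _).compl fun x => gDens n x * (F x)^2,
          restrict_compl_singleton]
    _ = ∫ z, (F z.1)^2 * (z.2.1^2 * ((2 * Real.pi) ^ (-(n:ℝ)/2) * Real.exp (-z.2.1^2/2)))
          ∂((volume : Measure (EE n)).toSphere.prod (.volumeIoiPow (n-1))) := by
        have := (volume : Measure (EE n)).measurePreserving_homeomorphUnitSphereProd.integral_comp
          (Homeomorph.measurableEmbedding _)
          (fun z : sphere (0 : EE n) 1 × Ioi (0:ℝ) => (F z.1)^2 * (z.2.1^2 * ((2 * Real.pi) ^ (-(n:ℝ)/2) * Real.exp (-z.2.1^2/2))))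
        simp only [finrank_euclideanSpace, Fintype.card_fin] at this
        rw [← this]
        congr 1; ext x
        have hx : x.1 ≠ 0 := x.2
        have hx' := norm_pos_iff.2 hx
        have e : F x.1 = ‖x.1‖ * F (‖x.1‖⁻¹ • x.1) := by
          rw [hsm, abs_of_pos (by positivity)]; field_simp
        simp only [homeomorphUnitSphereProd_apply_fst_coe, homeomorphUnitSphereProd_apply_snd_coe]
        rw [e]
        unfold gDens
        ring
    _ = _ := integral_prod_mul (fun θ : sphere (0 : EE n) 1 => (F θ)^2)
          (fun r : Ioi (0:ℝ) => r.1^2 * ((2 * Real.pi) ^ (-(n:ℝ)/2) * Real.exp (-r.1^2/2)))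

lemma Mval_gauss (n : ℕ) (hn : 1 ≤ n) (K : Set (EE n)) (hsm : ∀ (a : ℝ) x, gauge K (a • x) = |a| * gauge K x) :
    ∫ x, (gauge K x)^2 ∂(stdGaussian (EE n)) = n * (Mval K)^2 := by
  have h1 := gauss_polar n hn (gauge K) hsm
  have h2 := gauss_polar n hn (fun x => ‖x‖) (fun a x => by rw [norm_smul]; rfl)
  rw [norm_sq_int] at h2
  have h3 : ∫ θ : sphere (0 : EE n) 1, ‖(θ : EE n)‖^2 ∂((volume : Measure (EE n)).toSphere) =
      ((volume : Measure (EE n)).toSphere).real univ := by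
    simp
  rw [h3] at h2
  set J := ∫ r : Ioi (0:ℝ), r.1^2 * ((2 * Real.pi) ^ (-(n:ℝ)/2) * Real.exp (-r.1^2/2)) ∂(Measure.volumeIoiPow (n-1))
  clear_value J
  rw [Mval, Real.sq_sqrt, average_eq, h1, h2, smul_eq_mul]
  · have : ((volume : Measure (EE n)).toSphere).real univ ≠ 0 := by
      intro h
      rw [h] at h2
      simp at h2
      omega
    field_simp
  · rw [average_eq]
    exact smul_nonneg (by positivity) (integral_nonneg fun _ => by positivity)

open ProbabilityTheory

lemma vadd_ball {n : ℕ} (x : EE n) {lam : ℝ} (hl : 0 < lam) :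
    x +ᵥ (lam • closedBall (0 : EE n) 1) = closedBall x lam := by
  rw [_root_.smul_closedBall _ _ zero_le_one, vadd_closedBall]
  simp [abs_of_pos hl]

lemma NcovK_spec {n : ℕ} {T : Set (EE n)} (hT : IsCompact T) (hl : 0 < volRadius T) :
    ∃ t : Finset (EE n), t.card = NcovK T ∧ T ⊆ ⋃ x ∈ t, closedBall x (volRadius T) := by
  have hne : {N : ℕ | ∃ t : Finset (EE n), t.card = N ∧
      T ⊆ ⋃ x ∈ t, x +ᵥ (volRadius T • closedBall (0 : EE n) 1)}.Nonempty := by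
    obtain ⟨t, -, htf, ht⟩ := hT.finite_cover_balls hl
    refine ⟨htf.toFinset.card, htf.toFinset, rfl, ht.trans ?_⟩
    simp only [vadd_ball _ hl, Set.Finite.mem_toFinset]
    exact iUnion₂_mono fun x _ => ball_subset_closedBall
  obtain ⟨t, h1, h2⟩ := Nat.sInf_mem hne
  refine ⟨t, h1, ?_⟩
  simpa only [vadd_ball _ hl] using h2

lemma cover_vol {n k : ℕ} {T : Set (EE n)} (t : Finset (EE n)) (lam s r : ℝ) (hl : 0 ≤ lam) (hs : 0 ≤ s)
    (hr0 : 0 ≤ r) (hT : T ⊆ ⋃ x ∈ t, closedBall x lam) (L : EE n →ₗ[ℝ] EE k) (hL : ∀ x, ‖L x‖ ≤ s * ‖x‖)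
    (hr : ∀ p, ‖p‖ ≤ r → ∃ x ∈ T, L x = p) : r^k ≤ t.card * (s*lam)^k := by
  have h1 : closedBall (0 : EE k) r ⊆ ⋃ x ∈ t, closedBall (L x) (s * lam) := by
    intro p hp
    rw [mem_closedBall_zero_iff] at hp
    obtain ⟨x, hx, rfl⟩ := hr p hp
    obtain ⟨z, hz, hxz⟩ := mem_iUnion₂.1 (hT hx)
    refine mem_iUnion₂.2 ⟨z, hz, ?_⟩
    rw [mem_closedBall, dist_eq_norm] at hxz ⊢
    rw [← map_sub]
    exact (hL _).trans (by gcongr)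
  have h2 := (measure_mono (μ := volume) h1).trans (measure_biUnion_finset_le t _)
  simp only [Measure.addHaar_closedBall volume _ hr0, Measure.addHaar_closedBall volume _ (mul_nonneg hs hl), finrank_euclideanSpace, Fintype.card_fin, Finset.sum_const, nsmul_eq_mul, ← mul_assoc] at h2
  rw [ENNReal.mul_le_mul_iff_left (measure_ball_pos volume _ one_pos).ne' measure_ball_lt_top.ne,
    ← ENNReal.ofReal_natCast, ← ENNReal.ofReal_mul (by positivity), ENNReal.ofReal_le_ofReal_iff (by positivity)] at h2
  exact h2

def combL {n k : ℕ} (g : Fin k → EE n) : EE k →ₗ[ℝ] EE n where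
  toFun := comb g
  map_add' := comb_add g
  map_smul' := fun a y => by simpa using comb_smul g a y

lemma gauge_hom {n : ℕ} {K : Set (EE n)} (h : IsSymmetricConvexBody K) (a : ℝ) (x : EE n) :
    gauge K (a • x) = |a| * gauge K x := by
  have hn : ∀ x, gauge K (-x) = gauge K x := gauge_neg (fun x hx => by rw [h.2.2.2] at hx; exact hx)
  rcases le_total 0 a with ha | ha
  · rw [gauge_smul_of_nonneg ha, abs_of_nonneg ha]; rfl
  · have : a • x = -((-a) • x) := by simp
    rw [this, hn, gauge_smul_of_nonneg (by linarith), abs_of_nonpos ha]; rfl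

lemma gauge_tri {n : ℕ} {K : Set (EE n)} (h : IsSymmetricConvexBody K) (x y : EE n) :
    gauge K (x + y) ≤ gauge K x + gauge K y :=
  gauge_add_le h.1 (absorbent_nhds_zero (body_nhds h)) x y

lemma polar_lift {n k : ℕ} {K : Set (EE n)} (h : IsSymmetricConvexBody K) (g : Fin k → EE n) (r : ℝ) (hr : 0 < r)
    (hg : ∀ y, r * ‖y‖ ≤ gauge K (comb g y)) (p : EE k) (hp : ‖p‖ ≤ r) :
    ∃ x ∈ polarSet K, ∀ y, inner ℝ x (comb g y) = inner ℝ p y := by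
  have hinj : Function.Injective (combL g) := by
    rw [injective_iff_map_eq_zero]
    intro y hy
    have h1 := hg y
    have h2 : comb g y = 0 := hy
    rw [h2, gauge_zero] at h1
    have : ‖y‖ ≤ 0 := by
      by_contra! h3
      have := mul_pos hr h3
      linarith
    simpa using this
  set e := LinearEquiv.ofInjective (combL g) hinj
  set f : EE n →ₗ.[ℝ] ℝ := ⟨LinearMap.range (combL g), (innerSL ℝ p : EE k →L[ℝ] ℝ).toLinearMap ∘ₗ e.symm.toLinearMap⟩
  obtain ⟨φ, h1, h2⟩ := exists_extension_of_le_sublinear f (gauge K)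
    (fun c hc x => by rw [gauge_hom h, abs_of_pos hc]) (gauge_tri h) (by
      rintro ⟨_, y, rfl⟩
      have e1 : e.symm ⟨combL g y, y, rfl⟩ = y := by
        rw [LinearEquiv.symm_apply_eq]; rfl
      change inner ℝ p (e.symm ⟨combL g y, y, rfl⟩) ≤ gauge K (combL g y)
      rw [e1]
      exact (real_inner_le_norm _ _).trans ((by gcongr : ‖p‖ * ‖y‖ ≤ r * ‖y‖).trans (hg y)))
  refine ⟨(InnerProductSpace.toDual ℝ (EE n)).symm (LinearMap.toContinuousLinearMap φ), ?_, ?_⟩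
  · intro x hx
    rw [InnerProductSpace.toDual_symm_apply]
    exact (h2 x).trans (gauge_le_one_of_mem hx)
  · intro y
    rw [InnerProductSpace.toDual_symm_apply]
    have := h1 ⟨combL g y, y, rfl⟩
    have e1 : e.symm ⟨combL g y, y, rfl⟩ = y := by
      rw [LinearEquiv.symm_apply_eq]; rfl
    change φ (combL g y) = inner ℝ p (e.symm ⟨combL g y, y, rfl⟩) at this
    rw [e1] at this
    exact this

lemma cover_main {n k : ℕ} {K : Set (EE n)} (h : IsSymmetricConvexBody K) (g : Fin k → EE n) (r s : ℝ) (hr : 0 < r)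
    (hs : 0 ≤ s) (hg : ∀ y, r * ‖y‖ ≤ gauge K (comb g y)) (hgs : ∀ y, ‖comb g y‖ ≤ s * ‖y‖) :
    r^k ≤ NcovK (polarSet K) * (s * volRadius (polarSet K))^k := by
  have hTc := polar_compact h
  have hl := volRadius_pos hTc (Measure.measure_pos_of_mem_nhds volume (polar_nhds h)).ne'
  obtain ⟨t, ht, hcov⟩ := NcovK_spec hTc hl
  rw [← ht]
  set L := LinearMap.adjoint (combL g)
  have hL : ∀ x y, inner ℝ (L x) y = inner ℝ x (comb g y) := fun x y =>
    LinearMap.adjoint_inner_left (combL g) y x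
  refine cover_vol t _ s r hl.le hs hr.le hcov L ?_ ?_
  · intro x
    have h1 : ‖L x‖ ^ 2 ≤ ‖x‖ * (s * ‖L x‖) := by
      rw [← real_inner_self_eq_norm_sq, hL]
      exact (real_inner_le_norm _ _).trans (by gcongr; exact hgs _)
    by_contra! h2
    have h3 : 0 < ‖L x‖ := lt_of_le_of_lt (by positivity) h2
    nlinarith
  · intro p hp
    obtain ⟨x, hx, hxy⟩ := polar_lift h g r hr hg p hp
    refine ⟨x, hx, ext_inner_right ℝ fun y => ?_⟩
    rw [hL, hxy]

lemma gauge_le_cov {n : ℕ} {K : Set (EE n)} (h : IsSymmetricConvexBody K) (z : EE n) :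
    gauge K z ≤ NcovK (polarSet K) * volRadius (polarSet K) * ‖z‖ := by
  by_cases hz : z = 0
  · simp [hz]
  have hz' := norm_pos_iff.2 hz
  have hpos : 0 < gauge K z :=
    (gauge_pos (absorbent_nhds_zero (body_nhds h)) (NormedSpace.isVonNBounded_of_isBounded ℝ h.2.1.isBounded)).2 hz
  have hcomb : ∀ y : EE 1, comb (fun _ : Fin 1 => z) y = y 0 • z := by intro y; simp [comb]
  have hny : ∀ y : EE 1, ‖y‖ = |y 0| := by intro y; simp [EuclideanSpace.norm_eq, Real.sqrt_sq_eq_abs]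
  have := cover_main h (fun _ : Fin 1 => z) (gauge K z) ‖z‖ hpos hz'.le
    (fun y => by rw [hcomb, gauge_hom h, hny, mul_comm])
    (fun y => by rw [hcomb, norm_smul, hny, mul_comm]; rfl)
  linarith

open ProbabilityTheory

lemma Mval_nonneg {n : ℕ} (K : Set (EE n)) : 0 ≤ Mval K := Real.sqrt_nonneg _

lemma Mval_le {n : ℕ} (hn : 1 ≤ n) {K : Set (EE n)} (h : IsSymmetricConvexBody K) {B : ℝ}
    (hB : ∀ x, gauge K x ≤ B * ‖x‖) : (Mval K)^2 ≤ B^2 := by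
  have hn0 : (0:ℝ) < n := by exact_mod_cast hn
  have hi : Integrable (fun x : EE n => ‖x‖^2) (stdGaussian (EE n)) := by
    by_contra hni
    have h1 := norm_sq_int n
    rw [integral_undef hni] at h1
    linarith
  have h2 : ∫ x, (gauge K x)^2 ∂(stdGaussian (EE n)) ≤ ∫ x, B^2 * ‖x‖^2 ∂(stdGaussian (EE n)) := by
    refine integral_mono_of_nonneg (Filter.Eventually.of_forall fun x => by positivity) (hi.const_mul _)
      (Filter.Eventually.of_forall fun x => ?_)
    change gauge K x ^ 2 ≤ B^2 * ‖x‖^2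
    rw [← mul_pow]
    exact pow_le_pow_left₀ (gauge_nonneg x) (hB x) 2
  rw [integral_const_mul, norm_sq_int, Mval_gauss n hn K (gauge_hom h)] at h2
  nlinarith

lemma caseA {n : ℕ} (hn : 1 ≤ n) {K : Set (EE n)} (h : IsSymmetricConvexBody K) {b : ℝ} (hb0 : 0 < b)
    (hb : ∀ x, gauge K x ≤ b * ‖x‖) (hM : 0 < Mval K) (hA : 1000 * b^2 ≤ n * (Mval K)^2) :
    ∃ t : ℕ, (t:ℝ) ≤ 1000 * (b / Mval K)^2 ∧
      Mval K ≤ 16 * volRadius (polarSet K) * (NcovK (polarSet K) : ℝ)^((t:ℝ)/n) := by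
  have hn0 : (0:ℝ) < n := by exact_mod_cast hn
  have hlam := volRadius_pos (polar_compact h) (Measure.measure_pos_of_mem_nhds volume (polar_nhds h)).ne'
  have hF := seminorm_lip n hb0.le (gauge_tri h) hb
  have hsec := second_moment n hb0 hF
  rw [Mval_gauss n hn K (gauge_hom h)] at hsec
  have hMb := Mval_le hn h hb
  set M := Mval K
  set m := ∫ x, gauge K x ∂(stdGaussian (EE n)) with hm
  set lam := volRadius (polarSet K)
  set N := NcovK (polarSet K)
  have hm0 : 0 ≤ m := integral_nonneg fun x => gauge_nonneg x
  have hb2 : 0 < b^2 := by positivity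
  have hm1 : n * M^2 / 4 ≤ m^2 := by nlinarith
  have hm2 : 80 * b^2 ≤ m^2 := by nlinarith
  have hmpos : 0 < m := by
    rcases hm0.lt_or_eq with h1 | h1
    · exact h1
    · rw [← h1] at hm2; nlinarith
  set q := m^2 / (80 * b^2) with hq
  have hq1 : 1 ≤ q := by rw [hq, le_div_iff₀ (by positivity)]; linarith
  set k := ⌊q⌋₊
  have hk1 : 1 ≤ k := Nat.one_le_floor_iff q |>.2 hq1
  have hk0 : (0:ℝ) < k := by exact_mod_cast hk1
  have hkq : (k:ℝ) ≤ q := Nat.floor_le (by positivity)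
  have hkq2 : q ≤ 2 * k := by
    have := Nat.lt_floor_add_one q
    have h1 : (1:ℝ) ≤ k := by exact_mod_cast hk1
    linarith
  obtain ⟨g, hg⟩ := dvor n k hk1 hb0 (gauge_tri h) (gauge_hom h) hb hmpos (by
    rw [hq, le_div_iff₀ (by positivity)] at hkq
    linarith)
  have hc := cover_main h g (1/4*m) (2*√n) (by positivity) (by positivity)
    (fun y => (hg y).1) (fun y => (hg y).2)
  change (1/4*m)^k ≤ N * (2*√n*lam)^k at hc
  have hN1 : (1:ℝ) ≤ N := by
    rcases Nat.eq_zero_or_pos N with h0 | h0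
    · rw [h0] at hc
      have : 0 < (1/4*m)^k := by positivity
      simp at hc
      linarith
    · exact_mod_cast h0
  have hc2 : 1/4*m ≤ (N:ℝ)^((1:ℝ)/k) * (2*√n*lam) := by
    have := Real.rpow_le_rpow (by positivity) hc (by positivity : 0 ≤ (k:ℝ)⁻¹)
    rw [Real.mul_rpow (by positivity) (by positivity), Real.pow_rpow_inv_natCast (by positivity) (by omega),
      Real.pow_rpow_inv_natCast (by positivity) (by omega)] at this
    rwa [one_div (k:ℝ)]
  have hmM : √n * M / 2 ≤ m := by
    refine (abs_le_of_sq_le_sq' ?_ hm0).2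
    rw [div_pow, mul_pow, Real.sq_sqrt hn0.le]
    linarith
  have hsn : 0 < √(n:ℝ) := Real.sqrt_pos.2 hn0
  have hfin : M ≤ 16 * lam * (N:ℝ)^((1:ℝ)/k) := by
    have : √n * M ≤ √n * (16 * lam * (N:ℝ)^((1:ℝ)/k)) := by nlinarith
    exact le_of_mul_le_mul_left this hsn
  refine ⟨⌈(n:ℝ)/k⌉₊, ?_, hfin.trans ?_⟩
  · have h1 : (⌈(n:ℝ)/k⌉₊:ℝ) ≤ (n:ℝ)/k + 1 := (Nat.ceil_lt_add_one (by positivity)).le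
    have h2 : (1:ℝ) ≤ (b/M)^2 := by
      rw [div_pow, le_div_iff₀ (by positivity)]; linarith
    have h3 : (n:ℝ)/k ≤ 640 * (b/M)^2 := by
      rw [div_le_iff₀ hk0, div_pow, mul_div_assoc', div_mul_eq_mul_div, le_div_iff₀ (by positivity)]
      have h4 : m^2 ≤ 2*k*(80*b^2) := by
        rw [hq, div_le_iff₀ (by positivity)] at hkq2
        exact hkq2
      linarith
    linarith
  · refine mul_le_mul_of_nonneg_left (Real.rpow_le_rpow_of_exponent_le hN1 ?_) (by positivity)
    · rw [div_le_div_iff₀ hk0 hn0, one_mul]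
      exact (div_le_iff₀ hk0).1 (Nat.le_ceil _)

lemma main_pos {n : ℕ} (hn : 1 ≤ n) {K : Set (EE n)} (h : IsSymmetricConvexBody K) {b : ℝ}
    (hb : ∀ x, gauge K x ≤ b * ‖x‖) :
    ∃ t : ℕ, (t:ℝ) ≤ 1000 * (b / Mval K)^2 ∧
      Mval K ≤ 16 * volRadius (polarSet K) * (NcovK (polarSet K) : ℝ)^((t:ℝ)/n) := by
  have hn0 : (0:ℝ) < n := by exact_mod_cast hn
  have hlam := volRadius_pos (polar_compact h) (Measure.measure_pos_of_mem_nhds volume (polar_nhds h)).ne'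
  rcases (Mval_nonneg K).lt_or_eq with hM | hM
  swap
  · exact ⟨0, by simp; positivity, by rw [← hM]; positivity⟩
  have hb0 : 0 < b := by
    by_contra! hb0
    have := Mval_le hn h (B := 0) (fun x => (hb x).trans (by nlinarith [norm_nonneg x]))
    nlinarith
  by_cases hA : 1000 * b^2 ≤ n * (Mval K)^2
  · exact caseA hn h hb0 hb hM hA
  · push Not at hA
    refine ⟨n, ?_, ?_⟩
    · rw [div_pow, mul_div_assoc', le_div_iff₀ (by positivity)]; exact hA.le
    · rw [div_self hn0.ne', Real.rpow_one]
      have h1 := Mval_le hn h (gauge_le_cov h)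
      have h2 := abs_le_of_sq_le_sq h1 (by positivity)
      have h3 : (0:ℝ) ≤ NcovK (polarSet K) * volRadius (polarSet K) := by positivity
      linarith [le_abs_self (Mval K)]

/-- Lemma 5.2: there exist absolute constants `c, C > 0` such that if `K` is a
symmetric convex body in `ℝ^n` with `‖x‖_K ≤ b|x|` for all `x`, then
`M_K ≤ (c/λ_K) N_{K°}^{t/n}` for some natural number `t ≤ C (b/M_K)²`. -/
theorem Mvalue_le_volRadius_inv_mul_NcovK_polar_rpow :
    ∃ c : ℝ, ∃ C : ℝ, 0 < c ∧ 0 < C ∧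
      ∀ (n : ℕ) (K : Set (EuclideanSpace ℝ (Fin n))) (b : ℝ),
        IsSymmetricConvexBody K →
        (∀ x : EuclideanSpace ℝ (Fin n), gauge K x ≤ b * ‖x‖) →
        ∃ t : ℕ, (t : ℝ) ≤ C * (b / Mval K) ^ 2 ∧
          Mval K ≤ (c / volRadius K) *
            (NcovK (polarSet K) : ℝ) ^ ((t : ℝ) / n) := by
  refine ⟨8 * Real.pi * Real.exp 5, 1000, by positivity, by norm_num, ?_⟩
  intro n K b h hb
  have hlK := volRadius_pos h.2.1 (body_vol h)
  rcases Nat.eq_zero_or_pos n with hn | hn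
  · subst hn
    have hM : Mval K = 0 := by
      have : IsEmpty (sphere (0 : EuclideanSpace ℝ (Fin 0)) 1) := by
        refine ⟨fun x => ?_⟩
        have h1 := x.2
        rw [mem_sphere_zero_iff_norm, Subsingleton.elim x.1 0, norm_zero] at h1
        exact zero_ne_one h1
      unfold Mval
      rw [average_eq, integral_of_isEmpty]
      simp
    refine ⟨0, by simp; positivity, by rw [hM]; positivity⟩
  · obtain ⟨t, h1, h2⟩ := main_pos hn h hb
    refine ⟨t, h1, h2.trans ?_⟩
    have h3 := volRadius_mul hn h
    gcongr
    rw [le_div_iff₀ hlK]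
    linarith
end
end

section
/- Let E be an ellipsoid in ℝ^n. Then the successive minima of E with respect to the integer lattice ℤ^n satisfy λ_j(E) ≤ √(n/(n−j+1)) · M_E for j = 1,…,n. In particular, if M_E ≤ 1 then E contains an integer point different from the origin. -/
open MeasureTheory Metric Set
open scoped Pointwise

noncomputable section

/-- The integer lattice `ℤ^n ⊆ ℝ^n` (w.r.t. the standard orthonormal basis). -/
def intLattice (n : ℕ) : Set (EuclideanSpace ℝ (Fin n)) :=
  {x | ∀ i, ∃ z : ℤ, x i = (z : ℝ)}

/-- The `j`-th successive minimum of `E` with respect to the integer lattice: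
`λ_j(E) = min {λ > 0 : dim span(λE ∩ ℤ^n) ≥ j}`. -/
def succMin {n : ℕ} (E : Set (EuclideanSpace ℝ (Fin n))) (j : ℕ) : ℝ :=
  sInf {l : ℝ | 0 < l ∧
    j ≤ Module.finrank ℝ ↥(Submodule.span ℝ (l • E ∩ intLattice n))}

lemma gauge_ellipsoid {n : ℕ} (T : EuclideanSpace ℝ (Fin n) ≃ₗ[ℝ] EuclideanSpace ℝ (Fin n))
    (x : EuclideanSpace ℝ (Fin n)) : gauge (T '' closedBall 0 1) x = ‖T.symm x‖ := by
  have h := gauge_closedBall (E := EuclideanSpace ℝ (Fin n)) zero_le_one (T.symm x)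
  rw [div_one] at h
  rw [← h]
  unfold gauge
  congr 1
  ext r
  simp only [mem_ofPred_eq]
  refine and_congr_right fun _ => ?_
  rw [← Set.image_smul_comm T r (closedBall 0 1) (fun b => T.map_smul r b)]
  constructor
  · rintro ⟨y, hy, rfl⟩
    rw [T.symm_apply_apply]; exact hy
  · intro hy
    exact ⟨_, hy, T.apply_symm_apply x⟩

lemma sphere_integral_comp {n : ℕ}
    (L : EuclideanSpace ℝ (Fin n) ≃ₗᵢ[ℝ] EuclideanSpace ℝ (Fin n))
    (f : EuclideanSpace ℝ (Fin n) → ℝ) (hf : Continuous f) :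
    ∫ x : sphere (0 : EuclideanSpace ℝ (Fin n)) 1, f (L x)
      ∂((volume : Measure (EuclideanSpace ℝ (Fin n))).toSphere) =
    ∫ x : sphere (0 : EuclideanSpace ℝ (Fin n)) 1, f x
      ∂((volume : Measure (EuclideanSpace ℝ (Fin n))).toSphere) := by
  let φ : sphere (0 : EuclideanSpace ℝ (Fin n)) 1 → sphere (0 : EuclideanSpace ℝ (Fin n)) 1 :=
    fun x => ⟨L x, by have := x.2; simp at this ⊢⟩
  have hφ : Continuous φ := by
    apply Continuous.subtype_mk
    exact L.continuous.comp continuous_subtype_val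
  have hmap : Measure.map φ ((volume : Measure (EuclideanSpace ℝ (Fin n))).toSphere) =
      (volume : Measure (EuclideanSpace ℝ (Fin n))).toSphere := by
    ext s hs
    rw [Measure.map_apply hφ.measurable hs, Measure.toSphere_apply' _ hs,
      Measure.toSphere_apply' _ (hφ.measurable hs)]
    congr 1
    rw [← L.measurePreserving.measure_preimage_emb L.toHomeomorph.measurableEmbedding
      (Ioo (0:ℝ) 1 • (Subtype.val '' s))]
    congr 1
    ext y
    simp only [Set.mem_smul, mem_preimage, mem_image]
    constructor
    · rintro ⟨r, hr, _, ⟨x, hx, rfl⟩, rfl⟩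
      exact ⟨r, hr, _, ⟨φ x, hx, rfl⟩, by simp [φ]⟩
    · rintro ⟨r, hr, _, ⟨x, hx, rfl⟩, h⟩
      refine ⟨r, hr, L.symm x, ⟨⟨L.symm x, by have := x.2; simp at this ⊢⟩, ?_, rfl⟩, ?_⟩
      · have : φ ⟨L.symm x, by have := x.2; simp at this ⊢⟩ = x := by
          ext; simp [φ]
        rw [this]; exact hx
      · apply L.injective
        simp [h]
  conv_rhs => rw [← hmap]
  rw [integral_map hφ.measurable.aemeasurable]
  exact (hf.comp continuous_subtype_val).aestronglyMeasurable

set_option maxHeartbeats 1600000 in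
lemma Mval_ellipsoid {n : ℕ} (hn : 1 ≤ n)
    (T : EuclideanSpace ℝ (Fin n) ≃ₗ[ℝ] EuclideanSpace ℝ (Fin n)) :
    n * Mval (T '' closedBall 0 1) ^ 2 = ∑ i, ‖T.symm (EuclideanSpace.single i 1)‖ ^ 2 := by
  haveI : NeZero n := ⟨by omega⟩
  set σ := (volume : Measure (EuclideanSpace ℝ (Fin n))).toSphere with hσ
  have hint : ∀ f : EuclideanSpace ℝ (Fin n) → ℝ, Continuous f →
      Integrable (fun x : sphere (0 : EuclideanSpace ℝ (Fin n)) 1 => f x) σ := by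
    intro f hf
    exact (hf.comp continuous_subtype_val).integrable_of_hasCompactSupport
      (HasCompactSupport.of_compactSpace _)
  have hc : ∀ i : Fin n, Continuous fun x : EuclideanSpace ℝ (Fin n) => x i := by
    intro i; fun_prop
  have hoff : ∀ i j : Fin n, i ≠ j →
      ∫ x : sphere (0 : EuclideanSpace ℝ (Fin n)) 1, x.1 i * x.1 j ∂σ = 0 := by
    intro i j hij
    have := sphere_integral_comp (LinearIsometryEquiv.piLpCongrRight 2
      (fun k : Fin n => if k = i then LinearIsometryEquiv.neg ℝ else LinearIsometryEquiv.refl ℝ ℝ))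
      (fun x => x i * x j) ((hc i).mul (hc j))
    simp [LinearIsometryEquiv.piLpCongrRight_apply, hij.symm, integral_neg] at this
    linarith
  have hdiag : ∀ i j : Fin n,
      ∫ x : sphere (0 : EuclideanSpace ℝ (Fin n)) 1, x.1 i * x.1 i ∂σ =
      ∫ x : sphere (0 : EuclideanSpace ℝ (Fin n)) 1, x.1 j * x.1 j ∂σ := by
    intro i j
    have := sphere_integral_comp (LinearIsometryEquiv.piLpCongrLeft 2 ℝ ℝ (Equiv.swap i j))
      (fun x => x i * x i) ((hc i).mul (hc i))
    rw [← this]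
    simp [LinearIsometryEquiv.piLpCongrLeft_apply, Equiv.piCongrLeft', hσ]
  have htot : ∀ i : Fin n,
      n * ∫ x : sphere (0 : EuclideanSpace ℝ (Fin n)) 1, x.1 i * x.1 i ∂σ = σ.real univ := by
    intro i
    have h1 : ∫ x : sphere (0 : EuclideanSpace ℝ (Fin n)) 1, (∑ j, x.1 j * x.1 j) ∂σ
        = σ.real univ := by
      have : ∀ x : sphere (0 : EuclideanSpace ℝ (Fin n)) 1, (∑ j, x.1 j * x.1 j) = 1 := by
        intro x
        have h2 : ‖x.1‖ = 1 := by simpa using x.2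
        have h3 := EuclideanSpace.real_norm_sq_eq x.1
        rw [h2] at h3
        simp only [← sq]; linarith
      simp [this]
    rw [← h1, integral_finsetSum]
    · rw [Finset.sum_congr rfl (fun j _ => hdiag j i)]; simp
    · intro j _
      exact hint (fun x => x j * x j) ((hc j).mul (hc j))
  have hpos : 0 < σ.real univ := by
    rw [hσ, Measure.toSphere_real_apply_univ]
    have : 0 < (volume : Measure (EuclideanSpace ℝ (Fin n))).real (ball 0 1) :=
      ENNReal.toReal_pos (measure_ball_pos _ _ one_pos).ne' measure_ball_lt_top.ne
    have h2 : (0:ℝ) < n := by exact_mod_cast hn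
    simpa using mul_pos h2 this
  have hexp : ∀ x : EuclideanSpace ℝ (Fin n), ‖T.symm x‖ ^ 2 =
      ∑ i, ∑ j, x i * x j * inner ℝ (T.symm (EuclideanSpace.single i 1))
        (T.symm (EuclideanSpace.single j 1)) := by
    intro x
    have hx : x = ∑ i, x i • EuclideanSpace.single i (1:ℝ) := by
      ext k
      simp [Finset.sum_apply, Pi.single_apply]
    rw [← real_inner_self_eq_norm_sq]
    conv_lhs => rw [hx]
    simp only [map_sum, map_smul, sum_inner, inner_sum, inner_smul_left, inner_smul_right]
    refine Finset.sum_congr rfl fun i _ => ?_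
    rw [Finset.mul_sum]
    refine Finset.sum_congr rfl fun j _ => ?_
    rw [real_inner_comm, RCLike.conj_to_real]; ring
  unfold Mval
  rw [Real.sq_sqrt]
  · simp only [gauge_ellipsoid, ← hσ]
    have hI : ∫ x : sphere (0 : EuclideanSpace ℝ (Fin n)) 1, ‖T.symm x.1‖ ^ 2 ∂σ =
        ∫ x : sphere (0 : EuclideanSpace ℝ (Fin n)) 1, (∑ i, ∑ j, x.1 i * x.1 j *
          inner ℝ (T.symm (EuclideanSpace.single i 1))
            (T.symm (EuclideanSpace.single j 1))) ∂σ := by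
      congr 1
      funext x
      exact hexp x.1
    rw [average_eq, hI]
    rw [integral_finsetSum]
    · have : ∀ i : Fin n, ∫ x : sphere (0 : EuclideanSpace ℝ (Fin n)) 1,
          (∑ j, x.1 i * x.1 j * inner ℝ (T.symm (EuclideanSpace.single i 1))
            (T.symm (EuclideanSpace.single j 1))) ∂σ =
          σ.real univ / n * ‖T.symm (EuclideanSpace.single i 1)‖ ^ 2 := by
        intro i
        rw [integral_finsetSum]
        · rw [Finset.sum_eq_single i]
          · rw [integral_mul_const, real_inner_self_eq_norm_sq, ← htot i]
            field_simp
          · intro j _ hj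
            rw [integral_mul_const, hoff i j hj.symm, zero_mul]
          · simp
        · intro j _
          exact hint (fun x => x i * x j * _) (((hc i).mul (hc j)).mul continuous_const)
      rw [Finset.sum_congr rfl (fun i _ => this i), ← Finset.mul_sum, smul_eq_mul]
      have hn' : (n:ℝ) ≠ 0 := by exact_mod_cast (by omega)
      field_simp
    · intro i _
      exact hint (fun x => ∑ j, x i * x j * inner ℝ (T.symm (EuclideanSpace.single i 1))
        (T.symm (EuclideanSpace.single j 1)))
        (continuous_finsetSum _ fun j _ => ((hc i).mul (hc j)).mul continuous_const)
  · rw [average_eq, smul_eq_mul]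
    exact mul_nonneg (inv_nonneg.2 measureReal_nonneg) (integral_nonneg fun x => sq_nonneg _)

lemma finrank_ge {n : ℕ} (T : EuclideanSpace ℝ (Fin n) ≃ₗ[ℝ] EuclideanSpace ℝ (Fin n))
    (hn : 1 ≤ n) (j : ℕ) (h1 : 1 ≤ j) (hj : j ≤ n) :
    0 < Real.sqrt ((n : ℝ) / ((n : ℝ) - (j : ℝ) + 1)) * Mval (T '' closedBall 0 1) ∧
    j ≤ Module.finrank ℝ ↥(Submodule.span ℝ
      ((Real.sqrt ((n : ℝ) / ((n : ℝ) - (j : ℝ) + 1)) * Mval (T '' closedBall 0 1)) •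
        (T '' closedBall 0 1) ∩ intLattice n)) := by
  have hM := Mval_ellipsoid hn T
  have hM0 : 0 ≤ Mval (T '' closedBall 0 1) := Real.sqrt_nonneg _
  set M := Mval (T '' closedBall 0 1)
  set a : Fin n → ℝ := fun i => ‖T.symm (EuclideanSpace.single i 1)‖ with ha
  have hapos : ∀ i, 0 < a i := by
    intro i
    rw [ha]; simp
  have hn0 : (0:ℝ) < n := by exact_mod_cast hn
  have hd : (0:ℝ) < n - j + 1 := by
    have : (j:ℝ) ≤ n := by exact_mod_cast hj
    linarith
  set l := Real.sqrt ((n : ℝ) / ((n : ℝ) - (j : ℝ) + 1)) * M with hl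
  have hl2 : (n - j + 1) * l ^ 2 = ∑ i, a i ^ 2 := by
    rw [← hM, hl, mul_pow, Real.sq_sqrt (by positivity)]
    field_simp
  have hl0 : 0 ≤ l := by positivity
  have hsum : 0 < ∑ i, a i ^ 2 := by
    apply Finset.sum_pos
    · intro i _; exact pow_pos (hapos i) 2
    · exact ⟨⟨0, by omega⟩, Finset.mem_univ _⟩
  have hlpos : 0 < l := by
    rcases hl0.eq_or_lt with h | h
    · rw [← h] at hl2; simp at hl2; linarith
    · exact h
  refine ⟨hlpos, ?_⟩
  classical
  let s : Finset (Fin n) := Finset.univ.filter fun i => a i ≤ l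
  have hcard : j ≤ s.card := by
    by_contra hlt
    have hcc : s.card + sᶜ.card = n := by simpa using s.card_add_card_compl
    have hc : n - j + 1 ≤ sᶜ.card := by omega
    have hc' : (n:ℝ) - j + 1 ≤ (sᶜ.card : ℝ) := by
      have : ((n - j + 1 : ℕ) : ℝ) ≤ (sᶜ.card : ℝ) := by exact_mod_cast hc
      push_cast [Nat.cast_sub hj] at this
      exact this
    have hne : sᶜ.Nonempty := Finset.card_pos.1 (by omega)
    have h3 : ∑ i ∈ sᶜ, l ^ 2 < ∑ i ∈ sᶜ, a i ^ 2 := by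
      apply Finset.sum_lt_sum_of_nonempty hne
      intro i hi
      have : l < a i := by simpa [s] using hi
      exact pow_lt_pow_left₀ this hl0 (by norm_num)
    have h4 : ∑ i ∈ sᶜ, a i ^ 2 ≤ ∑ i, a i ^ 2 :=
      Finset.sum_le_sum_of_subset_of_nonneg (Finset.subset_univ _) (fun i _ _ => sq_nonneg _)
    rw [Finset.sum_const, nsmul_eq_mul] at h3
    have := mul_le_mul_of_nonneg_right hc' (sq_nonneg l)
    linarith
  have hli : LinearIndependent ℝ (fun i : s => EuclideanSpace.single (i : Fin n) (1:ℝ)) := by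
    have := (EuclideanSpace.basisFun (Fin n) ℝ).toBasis.linearIndependent.comp
      (Subtype.val : s → Fin n) Subtype.val_injective
    have e : ((EuclideanSpace.basisFun (Fin n) ℝ).toBasis ∘ (Subtype.val : s → Fin n)) =
        (fun i : s => EuclideanSpace.single (i : Fin n) (1:ℝ)) := by
      funext i; simp
    rw [e] at this
    exact this
  refine hcard.trans ?_
  have h5 := finrank_span_eq_card hli
  rw [Fintype.card_coe] at h5
  rw [← h5]
  apply Submodule.finrank_mono
  apply Submodule.span_mono
  rintro _ ⟨⟨i, hi⟩, rfl⟩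
  have hi : a i ≤ l := by simpa [s] using hi
  refine ⟨?_, ?_⟩
  · refine ⟨T (l⁻¹ • T.symm (EuclideanSpace.single i 1)), ⟨_, ?_, rfl⟩, ?_⟩
    · rw [mem_closedBall_zero_iff, norm_smul, Real.norm_of_nonneg (by positivity)]
      rw [inv_mul_le_iff₀ hlpos]; simpa using hi
    · simp [smul_smul, hlpos.ne']
  · intro k
    refine ⟨if k = i then 1 else 0, ?_⟩
    simp [Pi.single_apply]

/-- Fact I: for an ellipsoid `E` in `ℝ^n`, `λ_j(E) ≤ √(n/(n-j+1)) M_E` for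
`j = 1,…,n`; in particular, if `M_E ≤ 1` then `E` contains a nonzero integer
point. -/
theorem succMin_le_and_exists_lattice_point
    (n : ℕ) (hn : 1 ≤ n) (E : Set (EuclideanSpace ℝ (Fin n))) (hE : IsEllipsoid E) :
    (∀ j : ℕ, 1 ≤ j → j ≤ n →
        succMin E j ≤ Real.sqrt ((n : ℝ) / ((n : ℝ) - (j : ℝ) + 1)) * Mval E) ∧
      (Mval E ≤ 1 → ∃ x ∈ E ∩ intLattice n, x ≠ 0) := by
  obtain ⟨T, rfl⟩ := hE
  refine ⟨fun j h1 hj => ?_, fun hM => ?_⟩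
  · apply csInf_le
    · exact ⟨0, fun l hl => hl.1.le⟩
    · exact finrank_ge T hn j h1 hj
  · by_contra hcon
    push Not at hcon
    obtain ⟨hpos, hr⟩ := finrank_ge T hn 1 le_rfl hn
    have hn0 : (n:ℝ) ≠ 0 := by exact_mod_cast (by omega)
    have e : Real.sqrt ((n : ℝ) / ((n : ℝ) - ((1:ℕ) : ℝ) + 1)) = 1 := by
      simp [hn0]
    rw [e, one_mul] at hpos hr
    have : Submodule.span ℝ (Mval (T '' closedBall 0 1) • (T '' closedBall 0 1) ∩ intLattice n)
        = ⊥ := by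
      rw [Submodule.span_eq_bot]
      rintro x ⟨⟨_, ⟨y, hy, rfl⟩, rfl⟩, hx⟩
      refine hcon _ ⟨⟨Mval (T '' closedBall 0 1) • y, ?_, by simp⟩, hx⟩
      rw [mem_closedBall_zero_iff] at hy ⊢
      rw [norm_smul, Real.norm_of_nonneg hpos.le]
      exact mul_le_one₀ hM (norm_nonneg _) hy
    rw [this] at hr
    simp at hr
end
end

section
/- There exist absolute constants c₁, c₂ > 0 with c₂ < 1 such that: if E is an ellipsoid in ℝ^n with M_E < c₂, then the number of integer points in E satisfies |E ∩ ℤ^n| ≥ max over m ≤ c₁√n of C([c₂²/(m·M_E²)] choose within n) · 2^{[c₂²/(m·M_E²)]}, i.e. |E ∩ ℤ^n| ≥ max_{m ≤ c₁√n} binom(n, [c₂²/(m M_E²)]) · 2^{[c₂²/(m M_E²)]}. -/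
open MeasureTheory Metric Set
open scoped Pointwise

noncomputable section

namespace LatEll

abbrev Eu (n : ℕ) := EuclideanSpace ℝ (Fin n)

def sphMap {n : ℕ} (U : Eu n ≃ₗᵢ[ℝ] Eu n) : sphere (0 : Eu n) 1 ≃ₜ sphere (0 : Eu n) 1 where
  toFun x := ⟨U x, by simp⟩
  invFun x := ⟨U.symm x, by simp⟩
  left_inv x := by simp
  right_inv x := by simp
  continuous_toFun := by fun_prop
  continuous_invFun := by fun_prop

lemma sph_inv {n : ℕ} (U : Eu n ≃ₗᵢ[ℝ] Eu n) :
    MeasurePreserving (sphMap U) ((volume : Measure (Eu n)).toSphere)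
      ((volume : Measure (Eu n)).toSphere) := by
  refine ⟨(sphMap U).continuous.measurable, ?_⟩
  ext s hs
  have hm := (sphMap U).continuous.measurable
  rw [Measure.map_apply hm hs, Measure.toSphere_apply' _ (hm hs), Measure.toSphere_apply' _ hs]
  congr 1
  have : Ioo (0 : ℝ) 1 • ((↑) '' (sphMap U ⁻¹' s) : Set (Eu n))
      = U.toMeasurableEquiv ⁻¹' (Ioo (0 : ℝ) 1 • ((↑) '' s : Set (Eu n))) := by
    ext x
    simp only [Set.mem_smul, Set.mem_image, Set.mem_preimage]
    constructor
    · rintro ⟨r, hr, _, ⟨y, hy, rfl⟩, rfl⟩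
      refine ⟨r, hr, U y, ⟨sphMap U y, hy, rfl⟩, ?_⟩
      simp
    · rintro ⟨r, hr, _, ⟨y, hy, rfl⟩, h⟩
      refine ⟨r, hr, U.symm y, ⟨(sphMap U).symm y, by simpa using hy, rfl⟩, ?_⟩
      apply U.injective
      simpa using h
  rw [this]
  exact U.measurePreserving.measure_preimage_equiv (f := U.toMeasurableEquiv) _

lemma sph_integral {n : ℕ} (U : Eu n ≃ₗᵢ[ℝ] Eu n) (f : Eu n → ℝ) :
    ∫ x : sphere (0 : Eu n) 1, f (U x) ∂((volume : Measure (Eu n)).toSphere)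
      = ∫ x : sphere (0 : Eu n) 1, f x ∂((volume : Measure (Eu n)).toSphere) :=
  (sph_inv U).integral_comp (sphMap U).measurableEmbedding (fun x => f x)

def flip {n : ℕ} (i : Fin n) : Eu n ≃ₗᵢ[ℝ] Eu n :=
  LinearIsometryEquiv.piLpCongrRight 2
    (fun j => if j = i then LinearIsometryEquiv.neg ℝ else LinearIsometryEquiv.refl ℝ ℝ)

def swp {n : ℕ} (i j : Fin n) : Eu n ≃ₗᵢ[ℝ] Eu n :=
  LinearIsometryEquiv.piLpCongrLeft 2 ℝ ℝ (Equiv.swap i j)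

lemma sph_off {n : ℕ} {i j : Fin n} (h : i ≠ j) :
    ∫ x : sphere (0 : Eu n) 1, (x : Eu n) i * (x : Eu n) j
      ∂((volume : Measure (Eu n)).toSphere) = 0 := by
  have := sph_integral (flip i) (fun x => x i * x j)
  simp only [flip, LinearIsometryEquiv.piLpCongrRight_apply, if_true, if_neg h.symm,
    LinearIsometryEquiv.coe_neg, LinearIsometryEquiv.coe_refl, id, neg_mul,
    integral_neg] at this
  linarith

lemma sph_diag {n : ℕ} (i j : Fin n) :
    ∫ x : sphere (0 : Eu n) 1, (x : Eu n) i * (x : Eu n) i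
      ∂((volume : Measure (Eu n)).toSphere) = 
    ∫ x : sphere (0 : Eu n) 1, (x : Eu n) j * (x : Eu n) j
      ∂((volume : Measure (Eu n)).toSphere) := by
  have := sph_integral (swp i j) (fun x => x i * x i)
  simp only [swp, LinearIsometryEquiv.piLpCongrLeft_apply, Equiv.piCongrLeft'_apply,
    Equiv.symm_swap, Equiv.swap_apply_left] at this
  exact this.symm

lemma norm_sq_expand {n : ℕ} (S : Eu n →ₗ[ℝ] Eu n) (x : Eu n) :
    ‖S x‖ ^ 2 = ∑ i, ∑ j, (x i * x j) *
      inner ℝ (S (EuclideanSpace.single i 1)) (S (EuclideanSpace.single j 1)) := by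
  have hx : x = ∑ i, x i • EuclideanSpace.single i (1 : ℝ) := by
    ext k; simp [Finset.sum_apply, Pi.single_apply]
  rw [← real_inner_self_eq_norm_sq]
  conv_lhs => rw [hx]
  simp only [map_sum, map_smul, sum_inner, inner_sum, real_inner_smul_left, real_inner_smul_right]
  refine Finset.sum_congr rfl fun i _ => Finset.sum_congr rfl fun j _ => ?_
  rw [real_inner_comm]
  ring

lemma sum_collapse {n : ℕ} (A B : Fin n → Fin n → ℝ) (V : ℝ) (h0 : ∀ i j, i ≠ j → A i j = 0)
    (hd : ∀ i, A i i = V) : ∑ i, ∑ j, A i j * B i j = V * ∑ i, B i i := by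
  rw [Finset.mul_sum]
  refine Finset.sum_congr rfl fun i _ => ?_
  rw [Finset.sum_eq_single i, hd]
  · intro j _ hj; rw [h0 i j hj.symm, zero_mul]
  · simp

lemma gauge_ell {n : ℕ} (T : Eu n ≃ₗ[ℝ] Eu n) (x : Eu n) :
    gauge (T '' closedBall 0 1) x = ‖T.symm x‖ := by
  rw [← div_one ‖T.symm x‖, ← gauge_closedBall zero_le_one]
  unfold gauge
  congr 1
  ext r
  simp only [Set.mem_ofPred_eq, Set.mem_smul_set, Set.mem_image]
  refine and_congr_right fun _ => ?_
  constructor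
  · rintro ⟨_, ⟨y, hy, rfl⟩, rfl⟩
    exact ⟨y, hy, by simp⟩
  · rintro ⟨y, hy, h⟩
    exact ⟨T y, ⟨y, hy, rfl⟩, by rw [← map_smul, h]; simp⟩

lemma integ {n : ℕ} (f : sphere (0 : Eu n) 1 → ℝ) (hf : Continuous f) :
    Integrable f ((volume : Measure (Eu n)).toSphere) :=
  hf.integrable_of_hasCompactSupport (HasCompactSupport.of_compactSpace f)

lemma Mval_sq {n : ℕ} (hn : 0 < n) (T : Eu n ≃ₗ[ℝ] Eu n) :
    (n : ℝ) * Mval (T '' closedBall 0 1) ^ 2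
      = ∑ i, ‖T.symm (EuclideanSpace.single i 1)‖ ^ 2 := by
  have : Nonempty (Fin n) := ⟨⟨0, hn⟩⟩
  have i0 : Fin n := ⟨0, hn⟩
  set μ := (volume : Measure (Eu n)).toSphere with hμ
  set V := ∫ x : sphere (0 : Eu n) 1, (x : Eu n) i0 * (x : Eu n) i0 ∂μ with hV
  have hint : ∀ i j : Fin n, Integrable
      (fun x : sphere (0 : Eu n) 1 => (x : Eu n) i * (x : Eu n) j) μ := by
    intro i j; apply integ; fun_prop
  have h1 : (n : ℝ) * V = μ.real univ := by
    have : ∑ i : Fin n, ∫ x : sphere (0 : Eu n) 1, (x : Eu n) i * (x : Eu n) i ∂μ = n * V := by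
      rw [Finset.sum_congr rfl fun i _ => sph_diag i i0]; simp [hV, hμ]
    rw [← this, ← integral_finsetSum _ fun i _ => hint i i]
    have : ∀ x : sphere (0 : Eu n) 1, ∑ i, (x : Eu n) i * (x : Eu n) i = 1 := by
      intro x
      have h : ‖(x : Eu n)‖ = 1 := by simp
      have h2 := EuclideanSpace.norm_sq_eq (x : Eu n)
      rw [h] at h2
      simp only [Real.norm_eq_abs, sq_abs] at h2
      simp only [sq] at h2
      rw [← h2]; norm_num
    simp [this]
  have hpos : 0 < μ.real univ := by
    rw [hμ, Measure.toSphere_real_apply_univ]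
    refine mul_pos (by simpa using hn) ?_
    exact ENNReal.toReal_pos (measure_ball_pos _ _ one_pos).ne' measure_ball_lt_top.ne
  have h2 : ∫ x : sphere (0 : Eu n) 1, gauge (T '' closedBall 0 1) (x : Eu n) ^ 2 ∂μ
      = V * ∑ i, ‖T.symm (EuclideanSpace.single i 1)‖ ^ 2 := by
    have e : ∀ x : Eu n, gauge (T '' closedBall 0 1) x ^ 2 =
        ∑ i, ∑ j, (x i * x j) * inner ℝ (T.symm (EuclideanSpace.single i 1))
          (T.symm (EuclideanSpace.single j 1)) := fun x => by
      rw [gauge_ell]; exact norm_sq_expand T.symm.toLinearMap x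
    simp only [e]
    rw [integral_finsetSum _ fun i _ => integrable_finsetSum _ fun j _ => (hint i j).mul_const _]
    simp only [integral_finsetSum _ fun j _ => (hint _ j).mul_const _, integral_mul_const]
    rw [sum_collapse _ _ V (fun i j h => sph_off h) (fun i => sph_diag i i0)]
    simp only [real_inner_self_eq_norm_sq]
  unfold Mval
  rw [Real.sq_sqrt (by rw [average_eq]; positivity), average_eq, h2, ← h1, smul_eq_mul]
  have : (n : ℝ) * V ≠ 0 := by rw [h1]; exact hpos.ne'
  have hV0 : V ≠ 0 := right_ne_zero_of_mul this
  field_simp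

open Finset in
def P (n k : ℕ) : Finset (Fin n → ℤ) :=
  (Fintype.piFinset fun _ => Finset.Icc (-2 : ℤ) 2).filter
    fun z => (Finset.univ.filter fun i => z i ≠ 0).card = k

lemma mem_P {n k : ℕ} {z : Fin n → ℤ} : z ∈ P n k ↔ (∀ i, -2 ≤ z i ∧ z i ≤ 2) ∧
    (Finset.univ.filter fun i => z i ≠ 0).card = k := by
  simp [P]

lemma card_P (n k : ℕ) : (P n k).card = n.choose k * 4 ^ k := by
  rw [Finset.card_eq_sum_card_fiberwise (f := fun z => Finset.univ.filter fun i => z i ≠ 0)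
    (t := Finset.powersetCard k Finset.univ)]
  · rw [Finset.sum_congr rfl (g := fun _ => 4 ^ k), Finset.sum_const, Finset.card_powersetCard]
    · simp
    · intro I hI
      rw [Finset.mem_powersetCard] at hI
      have : (P n k).filter (fun z => (Finset.univ.filter fun i => z i ≠ 0) = I)
          = Fintype.piFinset (fun i => if i ∈ I then ({-2, -1, 1, 2} : Finset ℤ) else {0}) := by
        ext z
        simp only [Finset.mem_filter, mem_P, Fintype.mem_piFinset]
        constructor
        · rintro ⟨⟨h1, h2⟩, h3⟩ i
          have := h1 i
          split_ifs with h
          · rw [← h3] at h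
            simp at h ⊢
            omega
          · rw [← h3] at h
            simpa using h
        · intro h
          have h3 : (Finset.univ.filter fun i => z i ≠ 0) = I := by
            ext i
            have := h i
            by_cases hi : i ∈ I
            · simp [hi] at this ⊢; omega
            · simp [hi] at this ⊢; omega
          refine ⟨⟨fun i => ?_, by rw [h3]; exact hI.2⟩, h3⟩
          have := h i
          split_ifs at this <;> simp at this <;> omega
      rw [this, Fintype.card_piFinset]
      have : ∀ i, (if i ∈ I then ({-2, -1, 1, 2} : Finset ℤ) else {0}).card
          = if i ∈ I then 4 else 1 := by
        intro i; split_ifs <;> rfl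
      simp only [this, Finset.prod_ite_mem, Finset.univ_inter, Finset.prod_const, hI.2]
  · intro z hz
    have := (mem_P.1 hz).2
    simpa [Finset.mem_powersetCard] using this

lemma P_off {n k : ℕ} {i j : Fin n} (h : i ≠ j) :
    ∑ z ∈ P n k, ((z i : ℝ) * z j) = 0 := by
  have : ∑ z ∈ P n k, ((z i : ℝ) * z j) = ∑ z ∈ P n k, -((z i : ℝ) * z j) := by
    refine Finset.sum_nbij' (fun z => Function.update z i (-z i))
      (fun z => Function.update z i (-z i)) ?_ ?_ ?_ ?_ ?_
    all_goals try
      intro z hz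
      rw [mem_P] at hz ⊢
      refine ⟨fun l => ?_, ?_⟩
      · have := hz.1 l
        by_cases hl : l = i
        · subst hl; simp; omega
        · simpa [hl] using this
      · rw [← hz.2]
        congr 1; ext l
        by_cases hl : l = i
        · subst hl; simp
        · simp [hl]
    · intro z _; simp
    · intro z _; simp
    · intro z _; simp [h.symm]
  rw [Finset.sum_neg_distrib] at this
  linarith

lemma P_diag {n k : ℕ} (i j : Fin n) :
    ∑ z ∈ P n k, ((z i : ℝ) * z i) = ∑ z ∈ P n k, ((z j : ℝ) * z j) := by
  refine Finset.sum_nbij' (fun z => z ∘ Equiv.swap i j)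
      (fun z => z ∘ Equiv.swap i j) ?_ ?_ ?_ ?_ ?_
  all_goals try
    intro z hz
    rw [mem_P] at hz ⊢
    refine ⟨fun l => hz.1 _, ?_⟩
    rw [← hz.2]
    refine Finset.card_bij (fun l _ => Equiv.swap i j l) ?_ ?_ ?_
    · intro a ha; simpa using ha
    · intro a _ b _ hab; simpa using hab
    · intro b hb; exact ⟨Equiv.swap i j b, by simpa using hb, by simp⟩
  · intro z _; ext l; simp
  · intro z _; ext l; simp
  · intro z _; simp

def emb {n : ℕ} (z : Fin n → ℤ) : Eu n := WithLp.toLp 2 fun i => (z i : ℝ)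

lemma P_moment {n k : ℕ} (hn : 0 < n) (S : Eu n →ₗ[ℝ] Eu n) :
    (n : ℝ) * ∑ z ∈ P n k, ‖S (emb z)‖ ^ 2
      ≤ 4 * k * (P n k).card * ∑ i, ‖S (EuclideanSpace.single i 1)‖ ^ 2 := by
  have i0 : Fin n := ⟨0, hn⟩
  set V := ∑ z ∈ P n k, ((z i0 : ℝ) * z i0) with hV
  have h1 : (n : ℝ) * V ≤ 4 * k * (P n k).card := by
    have : ∑ i : Fin n, ∑ z ∈ P n k, ((z i : ℝ) * z i) = n * V := by
      rw [Finset.sum_congr rfl fun i _ => P_diag i i0]; simp [hV]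
    rw [← this, Finset.sum_comm]
    have : ∀ z ∈ P n k, ∑ i : Fin n, ((z i : ℝ) * z i) ≤ 4 * k := by
      intro z hz
      rw [mem_P] at hz
      calc ∑ i : Fin n, ((z i : ℝ) * z i) ≤ ∑ i : Fin n, if z i ≠ 0 then (4 : ℝ) else 0 := by
            refine Finset.sum_le_sum fun i _ => ?_
            have h := hz.1 i
            have h1 : (-2 : ℝ) ≤ z i := by exact_mod_cast h.1
            have h2 : (z i : ℝ) ≤ 2 := by exact_mod_cast h.2
            split_ifs with h0
            · nlinarith
            · simp at h0; simp [h0]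
        _ = 4 * k := by
            rw [← Finset.sum_filter, Finset.sum_const, hz.2]; simp; ring
    calc _ ≤ ∑ z ∈ P n k, (4 * k : ℝ) := Finset.sum_le_sum this
      _ = _ := by simp; ring
  have h2 : ∑ z ∈ P n k, ‖S (emb z)‖ ^ 2
      = V * ∑ i, ‖S (EuclideanSpace.single i 1)‖ ^ 2 := by
    rw [Finset.sum_congr rfl fun z _ => norm_sq_expand S (emb z)]
    rw [Finset.sum_comm]
    simp only [Finset.sum_comm (s := P n k), ← Finset.sum_mul]
    rw [sum_collapse (fun i j => ∑ z ∈ P n k, (emb z) i * (emb z) j) _ V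
      (fun i j h => P_off h) (fun i => P_diag i i0)]
    simp only [real_inner_self_eq_norm_sq]
  rw [h2, ← mul_assoc]
  gcongr

lemma emb_inj {n : ℕ} : Function.Injective (emb (n := n)) := by
  intro a b h
  ext i
  have : (emb a) i = (emb b) i := by rw [h]
  simpa [emb] using this

lemma fin_lat {n : ℕ} (T : Eu n ≃ₗ[ℝ] Eu n) :
    (T '' closedBall 0 1 ∩ intLattice n).Finite := by
  have hc : IsCompact (T '' closedBall (0 : Eu n) 1) :=
    (isCompact_closedBall 0 1).image (LinearMap.continuous_of_finiteDimensional T.toLinearMap)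
  obtain ⟨R, hR⟩ := hc.isBounded.subset_closedBall 0
  refine Set.Finite.subset (((Fintype.piFinset fun _ : Fin n =>
    Finset.Icc (-⌈R⌉) ⌈R⌉).finite_toSet).image emb) ?_
  rintro x ⟨hx, hl⟩
  choose z hz using hl
  refine ⟨z, ?_, by ext i; simp [emb, hz]⟩
  have hn : ‖x‖ ≤ R := by simpa using hR hx
  simp only [Finset.mem_coe, Fintype.mem_piFinset, Finset.mem_Icc]
  intro i
  have h1 : |x i| ≤ ⌈R⌉ := ((PiLp.norm_apply_le x i).trans hn).trans (Int.le_ceil R)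
  rw [hz, abs_le] at h1
  obtain ⟨h1, h2⟩ := h1
  constructor
  · have : ((-⌈R⌉ : ℤ) : ℝ) ≤ (z i : ℝ) := by push_cast; exact h1
    exact Int.cast_le.1 this
  · exact Int.cast_le.1 h2

end LatEll

/-- Fact II: there exist absolute constants `c₁, c₂ > 0` with `c₂ < 1` such that if
`E` is an ellipsoid in `ℝ^n` with `M_E < c₂`, then for every `m ≤ c₁√n`,
`|E ∩ ℤ^n| ≥ binom(n, [c₂²/(m M_E²)]) 2^{[c₂²/(m M_E²)]}`. -/
theorem card_lattice_points_in_ellipsoid :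
    ∃ c₁ : ℝ, ∃ c₂ : ℝ, 0 < c₁ ∧ 0 < c₂ ∧ c₂ < 1 ∧
      ∀ (n : ℕ) (E : Set (EuclideanSpace ℝ (Fin n))), IsEllipsoid E →
        Mval E < c₂ →
        ∀ m : ℕ, 1 ≤ m → (m : ℝ) ≤ c₁ * Real.sqrt n →
          Nat.choose n (Nat.floor (c₂ ^ 2 / ((m : ℝ) * Mval E ^ 2))) *
              2 ^ Nat.floor (c₂ ^ 2 / ((m : ℝ) * Mval E ^ 2)) ≤
            (E ∩ intLattice n).ncard := by
  refine ⟨1, 1/4, by norm_num, by norm_num, by norm_num, ?_⟩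
  rintro n E ⟨T, rfl⟩ - m hm hmn
  have hn : 0 < n := by
    rcases Nat.eq_zero_or_pos n with rfl | h
    · have : (1 : ℝ) ≤ m := by exact_mod_cast hm
      simp at hmn; subst hmn; omega
    · exact h
  set M := Mval (T '' closedBall 0 1) with hM
  set k := Nat.floor ((1/4 : ℝ) ^ 2 / ((m : ℝ) * M ^ 2)) with hk
  have hfin := LatEll.fin_lat T
  rcases Nat.eq_zero_or_pos k with h0 | hkpos
  · rw [h0]
    simp only [Nat.choose_zero_right, pow_zero, mul_one]
    rw [Nat.succ_le_iff, Set.ncard_pos hfin]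
    exact ⟨0, ⟨0, by simp, by simp⟩, fun i => ⟨0, by simp⟩⟩
  have hm1 : (1 : ℝ) ≤ m := by exact_mod_cast hm
  have hkM : (k : ℝ) * M ^ 2 ≤ 1 / 16 := by
    have h1 : (k : ℝ) ≤ (1/4 : ℝ) ^ 2 / ((m : ℝ) * M ^ 2) := Nat.floor_le (by positivity)
    have hM0 : 0 ≤ M ^ 2 := sq_nonneg M
    calc (k : ℝ) * M ^ 2 ≤ k * (m * M ^ 2) := by gcongr; nlinarith
      _ ≤ ((1/4 : ℝ) ^ 2 / ((m : ℝ) * M ^ 2)) * (m * M ^ 2) := by gcongr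
      _ ≤ (1/4 : ℝ) ^ 2 := by
          rcases eq_or_ne ((m : ℝ) * M ^ 2) 0 with h | h
          · rw [h]; norm_num
          · rw [div_mul_cancel₀ _ h]
      _ = 1 / 16 := by norm_num
  have hsum : ∑ z ∈ LatEll.P n k, ‖T.symm (LatEll.emb z)‖ ^ 2
      ≤ (LatEll.P n k).card / 4 := by
    have h := LatEll.P_moment (k := k) hn T.symm.toLinearMap
    simp only [LinearEquiv.coe_coe] at h
    rw [← LatEll.Mval_sq hn T] at h
    have hn' : (0 : ℝ) < n := by exact_mod_cast hn
    refine le_of_mul_le_mul_left (h.trans ?_) hn'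
    have hc : (0 : ℝ) ≤ n * (LatEll.P n k).card := by positivity
    nlinarith [mul_le_mul_of_nonneg_left hkM hc]
  have hbad : (((LatEll.P n k).filter fun z => ¬ ‖T.symm (LatEll.emb z)‖ ≤ 1).card : ℝ)
      ≤ (LatEll.P n k).card / 4 := by
    refine le_trans ?_ hsum
    rw [Finset.card_filter]
    push_cast
    refine Finset.sum_le_sum fun z _ => ?_
    split_ifs with h
    · simp
    · push Not at h
      nlinarith
  have hgood : ((LatEll.P n k).filter fun z => ‖T.symm (LatEll.emb z)‖ ≤ 1).card
      ≤ (T '' closedBall 0 1 ∩ intLattice n).ncard := by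
    rw [← Set.ncard_coe_finset, ← Set.ncard_image_of_injective _ LatEll.emb_inj]
    refine Set.ncard_le_ncard ?_ hfin
    rintro _ ⟨z, hz, rfl⟩
    simp only [Finset.coe_filter, Set.mem_ofPred_eq] at hz
    exact ⟨⟨T.symm (LatEll.emb z), by simpa using hz.2, by simp⟩, fun i => ⟨z i, rfl⟩⟩
  refine le_trans ?_ hgood
  have hadd := Finset.card_filter_add_card_filter_not (s := LatEll.P n k)
    (fun z => ‖T.symm (LatEll.emb z)‖ ≤ 1)
  have hcard := LatEll.card_P n k
  have h4 : 2 * (n.choose k * 2 ^ k) ≤ (LatEll.P n k).card := by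
    rw [hcard, show (4 : ℕ) = 2 * 2 from rfl, mul_pow]
    have : 2 ≤ 2 ^ k := by
      calc 2 = 2 ^ 1 := rfl
        _ ≤ 2 ^ k := Nat.pow_le_pow_right (by norm_num) hkpos
    nlinarith [Nat.zero_le (n.choose k * 2 ^ k)]
  have h4' : (2 * (n.choose k * 2 ^ k : ℕ) : ℝ) ≤ (LatEll.P n k).card := by exact_mod_cast h4
  have hadd' := congrArg (Nat.cast (R := ℝ)) hadd
  push_cast at hadd'
  have : ((n.choose k * 2 ^ k : ℕ) : ℝ)
      ≤ ((LatEll.P n k).filter fun z => ‖T.symm (LatEll.emb z)‖ ≤ 1).card := by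
    have : (0 : ℝ) ≤ (LatEll.P n k).card := by positivity
    linarith
  exact_mod_cast this
end
end
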